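/- arXiv:1104.3453 — 2 statements merged into one kernel-verified Lean document; each statement's English description precedes it below -/
import Mathlib

section
/- Let l, m, n be integers with m ≤ l and m < n, let Λ ⊂ ℝ^l be open, and let {P_λ : ℝⁿ → ℝ^m}_{λ∈Λ} be a family of maps satisfying conditions (2), (3) and (4) of transversality, and such that the map P : Λ × K → ℝ^m, (λ,x) ↦ P_λ(x), is continuous, Lipschitz continuous in the variable x, and twice differentiable with respect to λ, for each compact K ⊂ ℝⁿ. If E ⊂ ℝⁿ is H^m-measurable with H^m(E) < ∞ and E is purely m-unrectifiable, then H^m(P_λ(E)) = 0 for L^l-almost every λ ∈ Λ. -/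
open MeasureTheory Set Metric Matrix

/-- The matrix of a continuous linear map between Euclidean spaces with respect to the
standard bases. -/
noncomputable def matrixOf {l m : ℕ}
    (L : EuclideanSpace ℝ (Fin l) →L[ℝ] EuclideanSpace ℝ (Fin m)) :
    Matrix (Fin m) (Fin l) ℝ :=
  fun i j => L (EuclideanSpace.single j 1) i

/-- `Tmap P x y` is the map `λ ↦ (P_λ(x) - P_λ(y)) / |x - y|`. -/
noncomputable def Tmap {l n m : ℕ}
    (P : EuclideanSpace ℝ (Fin l) → EuclideanSpace ℝ (Fin n) → EuclideanSpace ℝ (Fin m))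
    (x y : EuclideanSpace ℝ (Fin n)) (lam : EuclideanSpace ℝ (Fin l)) :
    EuclideanSpace ℝ (Fin m) :=
  ‖x - y‖⁻¹ • (P lam x - P lam y)

/-- A family of maps `{P_λ : ℝⁿ → ℝ^m}_{λ ∈ Λ}` satisfying the weakened condition (1'):
`(λ,x) ↦ P_λ(x)` is continuous on `Λ × K`, Lipschitz continuous in the variable `x`, and twice
differentiable with respect to `λ`, together with conditions (2), (3), (4) of transversality:
(2) the first and second derivatives with respect to `λ` are uniformly bounded;
(3) whenever `|T_{x,y}(λ)| ≤ C_T`, then `det (D_λ T_{x,y}(λ) (D_λ T_{x,y}(λ))ᵀ) ≥ C_T ^ 2`;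
(4) the second derivative of `T_{x,y}` with respect to `λ` is uniformly bounded. -/
def IsTransversalFamilyLip {l n m : ℕ} (Λ : Set (EuclideanSpace ℝ (Fin l)))
    (P : EuclideanSpace ℝ (Fin l) → EuclideanSpace ℝ (Fin n) → EuclideanSpace ℝ (Fin m)) :
    Prop :=
  ∀ K : Set (EuclideanSpace ℝ (Fin n)), IsCompact K →
    -- (1')
    ((ContinuousOn (fun p => P p.1 p.2) (Λ ×ˢ K) ∧
      (∀ lam ∈ Λ, ∃ L : NNReal, LipschitzOnWith L (P lam) K) ∧
      ∀ lam ∈ Λ, ∀ x ∈ K, DifferentiableAt ℝ (fun μ => P μ x) lam ∧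
        DifferentiableAt ℝ (fun μ => fderiv ℝ (fun ν => P ν x) μ) lam) ∧
    -- (2)
    (∃ C₁ C₂ : ℝ, ∀ lam ∈ Λ, ∀ x ∈ K,
      ‖fderiv ℝ (fun μ => P μ x) lam‖ ≤ C₁ ∧
      ‖fderiv ℝ (fun μ => fderiv ℝ (fun ν => P ν x) μ) lam‖ ≤ C₂) ∧
    -- (3)
    (∃ C_T : ℝ, 0 < C_T ∧ ∀ lam ∈ Λ, ∀ x ∈ K, ∀ y ∈ K, x ≠ y →
      ‖Tmap P x y lam‖ ≤ C_T →
      C_T ^ 2 ≤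
        (matrixOf (fderiv ℝ (Tmap P x y) lam) * (matrixOf (fderiv ℝ (Tmap P x y) lam))ᵀ).det) ∧
    -- (4)
    (∃ C_L : ℝ, ∀ lam ∈ Λ, ∀ x ∈ K, ∀ y ∈ K, x ≠ y →
      ‖fderiv ℝ (fun μ => fderiv ℝ (Tmap P x y) μ) lam‖ ≤ C_L))

/-- A set `A ⊆ ℝⁿ` is purely `m`-unrectifiable if `H^m (A ∩ f(ℝ^m)) = 0` for every
Lipschitz map `f : ℝ^m → ℝⁿ`. -/
def PurelyUnrectifiable (m n : ℕ) (A : Set (EuclideanSpace ℝ (Fin n))) : Prop :=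
  ∀ f : EuclideanSpace ℝ (Fin m) → EuclideanSpace ℝ (Fin n),
    (∃ K : NNReal, LipschitzWith K f) → μH[m] (A ∩ Set.range f) = 0

open Filter Module
open scoped ENNReal Topology

section Covering

variable {Y : Type*} [NormedAddCommGroup Y] [NormedSpace ℝ Y] [FiniteDimensional ℝ Y]
  [MeasurableSpace Y] [BorelSpace Y]

/-- A covering estimate: if the part of `Q` lying over each ball `B(f a, 5 r(a))` is controlled by
`r(a) ^ dim Y` and the balls `B(f a, r(a))` stay in `V`, then `Q` is controlled by the volume
of `V`. -/
theorem outerMeasure_mul_unitBall_le_of_vitali {Z : Type*} (Φ : OuterMeasure Z)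
    (ν : Measure Y) [ν.IsAddHaarMeasure] (f : Z → Y) (Q : Set Z) (V : Set Y) (r : Z → ℝ)
    (R K : ℝ) (hK : 0 ≤ K) (hr : ∀ a ∈ Q, 0 < r a) (hrR : ∀ a ∈ Q, r a ≤ R)
    (hV : ∀ a ∈ Q, closedBall (f a) (r a) ⊆ V)
    (hΦ : ∀ a ∈ Q, Φ (Q ∩ f ⁻¹' closedBall (f a) (5 * r a)) ≤
      ENNReal.ofReal (K * r a ^ finrank ℝ Y)) :
    Φ Q * ν (closedBall 0 1) ≤ ENNReal.ofReal K * ν V := by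
  obtain ⟨u, huQ, hdisj, hcov⟩ := Vitali.exists_disjoint_subfamily_covering_enlargement_closedBall
    Q f r R hrR 5 (by norm_num)
  have hucount : u.Countable := hdisj.countable_of_nonempty_interior fun a ha => by
    refine ⟨f a, ?_⟩
    exact ball_subset_interior_closedBall (mem_ball_self (hr a (huQ ha)))
  have hsub : Q ⊆ ⋃ b ∈ u, Q ∩ f ⁻¹' closedBall (f b) (5 * r b) := by
    intro a ha
    obtain ⟨b, hb, hab⟩ := hcov a ha
    exact mem_iUnion₂.2 ⟨b, hb, ha, hab (mem_closedBall_self (hr a ha).le)⟩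
  calc Φ Q * ν (closedBall 0 1)
      ≤ (∑' b : u, ENNReal.ofReal (K * r b ^ finrank ℝ Y)) * ν (closedBall 0 1) := by
        gcongr
        have := hucount.to_subtype
        calc Φ Q ≤ Φ (⋃ b : u, Q ∩ f ⁻¹' closedBall (f b) (5 * r b)) := by
              apply Φ.mono
              rwa [← biUnion_eq_iUnion (t := fun b _ => Q ∩ f ⁻¹' closedBall (f b) (5 * r b))]
          _ ≤ ∑' b : u, Φ (Q ∩ f ⁻¹' closedBall (f b) (5 * r b)) := measure_iUnion_le _
          _ ≤ _ := ENNReal.tsum_le_tsum fun b => hΦ b (huQ b.2)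
    _ = ∑' b : u, ENNReal.ofReal K * ν (closedBall (f b) (r b)) := by
        rw [← ENNReal.tsum_mul_right]
        refine tsum_congr fun b => ?_
        rw [Measure.addHaar_closedBall' ν _ (hr b (huQ b.2)).le, ENNReal.ofReal_mul hK, mul_assoc]
    _ = ENNReal.ofReal K * ν (⋃ b ∈ u, closedBall (f b) (r b)) := by
        rw [ENNReal.tsum_mul_left, measure_biUnion hucount hdisj
          fun b _ => measurableSet_closedBall]
    _ ≤ ENNReal.ofReal K * ν V := by
        gcongr
        exact iUnion₂_subset fun b hb => hV b (huQ hb)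

/-- If an outer measure `Ψ` vanishes on a measurable set `A` and satisfies
`Ψ(B(t, s)) ≤ M s ^ dim Y` at the points of `A`, then `Ψ(B(t, s)) = o(s ^ dim Y)` at almost every
point of `A`. -/
theorem ae_outerMeasure_closedBall_le_of_eq_zero (Ψ : OuterMeasure Y) (ν : Measure Y)
    [ν.IsAddHaarMeasure] {A : Set Y} (hA : MeasurableSet A) (hΨA : Ψ A = 0) {M R : ℝ} (hM : 0 ≤ M)
    (hR : 0 < R)
    (hΨ : ∀ t ∈ A, ∀ s, 0 < s → s ≤ R →
      Ψ (closedBall t s) ≤ ENNReal.ofReal (M * s ^ finrank ℝ Y))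
    {ε : ℝ} (hε : 0 < ε) :
    ∀ᵐ t ∂ν, t ∈ A → ∀ᶠ s in 𝓝[>] (0 : ℝ),
      Ψ (closedBall t s) ≤ ENNReal.ofReal (ε * s ^ finrank ℝ Y) := by
  set d := finrank ℝ Y with hd
  set c := ν (closedBall 0 1) with hc
  have hc0 : c ≠ 0 := (measure_closedBall_pos ν 0 one_pos).ne'
  have hctop : c ≠ ⊤ := measure_closedBall_lt_top.ne
  set K := M * 13 ^ d with hKdef
  have hK : 0 ≤ K := by positivity
  -- `η` is the density threshold for the complement of `A`
  obtain ⟨η, hη0, hη⟩ : ∃ η : ℝ, 0 < η ∧ K * (η * 2 ^ d) ≤ ε := by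
    refine ⟨ε / ((K + 1) * 2 ^ d), by positivity, ?_⟩
    have : K * (ε / ((K + 1) * 2 ^ d) * 2 ^ d) = ε * (K / (K + 1)) := by
      field_simp
    rw [this]
    have : K / (K + 1) ≤ 1 := by rw [div_le_one (by positivity)]; linarith
    nlinarith
  filter_upwards [Besicovitch.ae_tendsto_measure_inter_div_of_measurableSet ν hA.compl]
    with t ht htA
  have ht0 : Aᶜ.indicator (1 : Y → ℝ≥0∞) t = 0 := by simp [htA]
  rw [ht0] at ht
  have h2 : Tendsto (fun s : ℝ => 2 * s) (𝓝[>] 0) (𝓝[>] 0) := by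
    refine tendsto_nhdsWithin_iff.2 ⟨?_, ?_⟩
    · exact (((continuous_const.mul continuous_id).tendsto' (0 : ℝ) 0 (by simp)).mono_left
        nhdsWithin_le_nhds)
    · filter_upwards [self_mem_nhdsWithin] with s hs
      simpa using hs
  have hev := (ht.comp h2).eventually (gt_mem_nhds (ENNReal.ofReal_pos.2 hη0))
  filter_upwards [hev, self_mem_nhdsWithin, Ioo_mem_nhdsGT (show (0:ℝ) < R / 4 by positivity)]
    with s hs hs0 hsR
  have hs0 : 0 < s := hs0
  have hball : ν (closedBall t (2 * s)) = ENNReal.ofReal ((2 * s) ^ d) * c :=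
    Measure.addHaar_closedBall' ν t (by positivity)
  have hmeas : ν (Aᶜ ∩ closedBall t (2 * s)) < ENNReal.ofReal (η * (2 * s) ^ d) * c := by
    have h := (ENNReal.div_lt_iff (Or.inl (measure_closedBall_pos ν t (by positivity)).ne')
      (Or.inl measure_closedBall_lt_top.ne)).1 hs
    rwa [hball, ← mul_assoc, ← ENNReal.ofReal_mul hη0.le] at h
  obtain ⟨V, hVsup, hVo, hV⟩ := Set.exists_isOpen_lt_of_lt _ _ hmeas
  have hrad : ∀ p ∈ closedBall t s \ A, ∃ ρ : ℝ, 0 < ρ ∧ ρ ≤ s / 4 ∧ closedBall p ρ ⊆ V ∧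
      ∃ q ∈ A, dist p q ≤ 8 * ρ := by
    rintro p ⟨hps, hpA⟩
    have hps' : dist p t ≤ s := hps
    rcases (infDist_nonneg (x := p) (s := A)).eq_or_lt with h0 | hpos
    · have hpV : p ∈ V := hVsup ⟨hpA, closedBall_subset_closedBall (by linarith) hps⟩
      obtain ⟨ρ, hρ, hρV⟩ := nhds_basis_closedBall.mem_iff.1 (hVo.mem_nhds hpV)
      refine ⟨min ρ (s / 4), by positivity, min_le_right _ _,
        (closedBall_subset_closedBall (min_le_left _ _)).trans hρV, ?_⟩
      obtain ⟨q, hq, hpq⟩ := (infDist_lt_iff ⟨t, htA⟩).1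
        (show infDist p A < 8 * min ρ (s / 4) by rw [← h0]; positivity)
      exact ⟨q, hq, hpq.le⟩
    · have hle : infDist p A ≤ s := (infDist_le_dist_of_mem htA).trans hps'
      refine ⟨infDist p A / 4, by positivity, by linarith, ?_, ?_⟩
      · intro z hz
        have hz' : dist z p ≤ infDist p A / 4 := hz
        refine hVsup ⟨fun hzA => ?_, ?_⟩
        · have := infDist_le_dist_of_mem (x := p) hzA
          rw [dist_comm] at this
          linarith
        · have := dist_triangle z p t
          simp only [mem_closedBall]; linarith
      · obtain ⟨q, hq, hpq⟩ := (infDist_lt_iff ⟨t, htA⟩).1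
          (show infDist p A < 8 * (infDist p A / 4) by linarith)
        exact ⟨q, hq, hpq.le⟩
  choose! ρ hρ0 hρs hρV q hqA hpq using hrad
  have hmain := outerMeasure_mul_unitBall_le_of_vitali Ψ ν id (closedBall t s \ A) V ρ (s / 4) K hK
    hρ0 hρs hρV (by
      intro p hp
      have h1 : 0 < ρ p := hρ0 p hp
      have h2 := hρs p hp
      calc Ψ (closedBall t s \ A ∩ id ⁻¹' closedBall (id p) (5 * ρ p))
          ≤ Ψ (closedBall (q p) (13 * ρ p)) := by
            apply Ψ.mono
            rintro z ⟨-, hz⟩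
            have hz' : dist z p ≤ 5 * ρ p := hz
            have := dist_triangle z p (q p)
            have := hpq p hp
            simp only [mem_closedBall]; linarith
        _ ≤ ENNReal.ofReal (M * (13 * ρ p) ^ d) :=
            hΨ _ (hqA p hp) _ (by positivity) (by linarith [hsR.2])
        _ = ENNReal.ofReal (K * ρ p ^ d) := by
            congr 1; rw [hKdef]; ring)
  have hfin : Ψ (closedBall t s \ A) * c ≤ ENNReal.ofReal (ε * s ^ d) * c := by
    calc Ψ (closedBall t s \ A) * c ≤ ENNReal.ofReal K * ν V := hmain
      _ ≤ ENNReal.ofReal K * (ENNReal.ofReal (η * (2 * s) ^ d) * c) := by gcongr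
      _ = ENNReal.ofReal (K * (η * (2 * s) ^ d)) * c := by
          rw [← mul_assoc, ← ENNReal.ofReal_mul hK]
      _ ≤ ENNReal.ofReal (ε * s ^ d) * c := by
          gcongr ENNReal.ofReal ?_ * c
          calc K * (η * (2 * s) ^ d) = K * (η * 2 ^ d) * s ^ d := by rw [mul_pow]; ring
            _ ≤ ε * s ^ d := by gcongr
  calc Ψ (closedBall t s) ≤ Ψ (A ∪ (closedBall t s \ A)) := by
        apply Ψ.mono; simp
    _ ≤ Ψ A + Ψ (closedBall t s \ A) := measure_union_le _ _
    _ = Ψ (closedBall t s \ A) := by rw [hΨA, zero_add]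
    _ ≤ ENNReal.ofReal (ε * s ^ d) := (ENNReal.mul_le_mul_iff_left hc0 hctop).1 hfin

end Covering

section Cones

variable {X : Type*} [MetricSpace X] [MeasurableSpace X]
  {Y : Type*} [NormedAddCommGroup Y] [NormedSpace ℝ Y] [FiniteDimensional ℝ Y]
  [MeasurableSpace Y] [BorelSpace Y]

/-- If every cone with vertex in `Q` carries little measure and `Q` has no part on which `f` is
bi-Lipschitz, then the measure of `Q` is small compared with its diameter. -/
theorem measure_le_diam_pow_of_cone (μ : Measure X) (f : X → Y) {L : NNReal}
    (hf : LipschitzWith L f) {Q : Set X}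
    (hQ : ∀ S ⊆ Q, ∀ c : ℝ, 0 < c → (∀ x ∈ S, ∀ y ∈ S, c * dist x y ≤ dist (f x) (f y)) → μ S = 0)
    {s δ ε D : ℝ} (hs : 0 < s) (hs1 : s ≤ 1) (hε : 0 ≤ ε) (hDδ : 2 * D < δ)
    (hD : ∀ x ∈ Q, ∀ y ∈ Q, dist x y ≤ D)
    (hcone : ∀ a ∈ Q, ∀ r, 0 < r → r < δ →
      μ (Q ∩ {x | dist x a < r ∧ dist (f x) (f a) < s * dist x a}) ≤
        ENNReal.ofReal (ε * (r * s) ^ finrank ℝ Y)) :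
    μ Q ≤ ENNReal.ofReal (2 * ε * (40 * (L + 1)) ^ finrank ℝ Y * D ^ finrank ℝ Y) := by
  set d := finrank ℝ Y with hd
  let S : X → Set ℝ := fun a =>
    {h | ∃ x ∈ Q, dist x a = h ∧ dist (f x) (f a) < s / 4 * dist x a}
  set Q₀ : Set X := {a ∈ Q | S a = ∅} with hQ₀
  have hQ₀null : μ Q₀ = 0 := by
    refine hQ Q₀ (sep_subset _ _) (s / 4) (by positivity) fun x hx y hy => ?_
    by_contra! hlt
    exact (eq_empty_iff_forall_notMem.1 hy.2) (dist x y) ⟨x, hx.1, rfl, hlt⟩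
  rcases Q.eq_empty_or_nonempty with rfl | ⟨a₀, ha₀⟩
  · simp
  have hD0 : 0 ≤ D := by simpa using hD a₀ ha₀ a₀ ha₀
  let h : X → ℝ := fun a => sSup (S a)
  have hSD : ∀ a ∈ Q, ∀ t ∈ S a, t ≤ D := by
    rintro a ha t ⟨x, hx, rfl, -⟩
    exact hD x hx a ha
  have hne : ∀ a ∈ Q \ Q₀, (S a).Nonempty := fun a ha => by
    by_contra hcon
    exact ha.2 ⟨ha.1, not_nonempty_iff_eq_empty.1 hcon⟩
  have hhD : ∀ a ∈ Q \ Q₀, h a ≤ D := fun a ha => csSup_le (hne a ha) (hSD a ha.1)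
  have hSh : ∀ a ∈ Q, ∀ t ∈ S a, t ≤ h a := fun a ha t ht => le_csSup ⟨D, hSD a ha⟩ ht
  have hh0 : ∀ a ∈ Q \ Q₀, 0 < h a := by
    intro a ha
    obtain ⟨t, x, hx, rfl, hxa⟩ := hne a ha
    refine lt_of_lt_of_le ?_ (hSh a ha.1 _ ⟨x, hx, rfl, hxa⟩)
    have := dist_nonneg (x := f x) (y := f a)
    by_contra! h0
    nlinarith
  let ν : Measure Y := Measure.addHaar
  set c := ν (closedBall 0 1) with hc
  have hc0 : c ≠ 0 := (measure_closedBall_pos ν 0 one_pos).ne'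
  have hctop : c ≠ ⊤ := measure_closedBall_lt_top.ne
  have hmain := outerMeasure_mul_unitBall_le_of_vitali μ.toOuterMeasure ν f (Q \ Q₀)
    (closedBall (f a₀) ((L + 1) * D)) (fun a => s * h a / 20) D (2 * ε * 40 ^ d) (by positivity)
    (fun a ha => by have := hh0 a ha; positivity)
    (fun a ha => by
      have := hh0 a ha; have := hhD a ha
      nlinarith)
    (fun a ha => by
      have h0 := hh0 a ha
      have h1 := hhD a ha
      refine closedBall_subset_closedBall' ?_
      have h2 : dist (f a) (f a₀) ≤ L * D := (hf.dist_le_mul a a₀).trans (by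
        gcongr; exact hD a ha.1 a₀ ha₀)
      nlinarith)
    (by
      intro a ha
      have h0 := hh0 a ha
      have h1 := hhD a ha
      obtain ⟨t, ⟨x, hxQ, rfl, hxa⟩, hxh⟩ := exists_lt_of_lt_csSup (hne a ha)
        (show 3 / 4 * h a < sSup (S a) by change 3 / 4 * h a < h a; linarith)
      have hxh' : dist x a ≤ h a := hSh a ha.1 _ ⟨x, hxQ, rfl, hxa⟩
      have hsub : (Q \ Q₀) ∩ f ⁻¹' closedBall (f a) (5 * (s * h a / 20)) ⊆
          (Q ∩ {z | dist z a < 2 * h a ∧ dist (f z) (f a) < s * dist z a}) ∪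
          (Q ∩ {z | dist z x < 2 * h a ∧ dist (f z) (f x) < s * dist z x}) := by
        rintro z ⟨hz, hzf⟩
        have hzf : dist (f z) (f a) ≤ s * h a / 4 := by
          have : dist (f z) (f a) ≤ 5 * (s * h a / 20) := hzf
          linarith
        have hza : dist z a ≤ h a := by
          by_contra! hlt
          have : dist (f z) (f a) < s / 4 * dist z a := by nlinarith
          exact absurd (hSh a ha.1 _ ⟨z, hz.1, rfl, this⟩) (not_le.2 hlt)
        rcases lt_or_ge (h a / 4) (dist z a) with hbig | hsmall
        · refine Or.inl ⟨hz.1, by linarith, ?_⟩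
          calc dist (f z) (f a) ≤ s * (h a / 4) := by linarith
            _ < s * dist z a := by gcongr
        · have htri := dist_triangle x z a
          rw [dist_comm x z] at htri
          have htri' := dist_triangle z a x
          rw [dist_comm a x] at htri'
          refine Or.inr ⟨hz.1, by linarith, ?_⟩
          calc dist (f z) (f x) ≤ dist (f z) (f a) + dist (f a) (f x) := dist_triangle _ _ _
            _ ≤ s * h a / 4 + s / 4 * h a := by
                rw [dist_comm (f a)]
                gcongr
                exact hxa.le.trans (by gcongr)
            _ = s * (h a / 2) := by ring
            _ < s * dist z x := by gcongr; linarith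
      calc μ.toOuterMeasure ((Q \ Q₀) ∩ f ⁻¹' closedBall (f a) (5 * (s * h a / 20)))
          ≤ μ (Q ∩ {z | dist z a < 2 * h a ∧ dist (f z) (f a) < s * dist z a}) +
            μ (Q ∩ {z | dist z x < 2 * h a ∧ dist (f z) (f x) < s * dist z x}) :=
            (measure_mono hsub).trans (measure_union_le _ _)
        _ ≤ ENNReal.ofReal (ε * (2 * h a * s) ^ d) + ENNReal.ofReal (ε * (2 * h a * s) ^ d) :=
            add_le_add (hcone a ha.1 _ (by positivity) (by linarith))
              (hcone x hxQ _ (by positivity) (by linarith))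
        _ = ENNReal.ofReal (2 * ε * 40 ^ d * (s * h a / 20) ^ d) := by
            rw [← ENNReal.ofReal_add (by positivity) (by positivity), mul_assoc (2 * ε),
              ← mul_pow]
            congr 1
            rw [show 40 * (s * h a / 20) = 2 * h a * s by ring]
            ring)
  have hQQ : μ Q ≤ μ (Q \ Q₀) := by
    calc μ Q ≤ μ (Q₀ ∪ Q \ Q₀) := measure_mono (by simp)
      _ ≤ μ Q₀ + μ (Q \ Q₀) := measure_union_le _ _
      _ = μ (Q \ Q₀) := by rw [hQ₀null, zero_add]
  refine hQQ.trans ((ENNReal.mul_le_mul_iff_left hc0 hctop).1 (hmain.trans_eq ?_))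
  rw [Measure.addHaar_closedBall' ν _ (by positivity), ← mul_assoc,
    ← ENNReal.ofReal_mul (by positivity)]
  congr 2
  rw [mul_pow, mul_pow]; ring

theorem hausdorffMeasure_eq_zero_of_cone [BorelSpace X] (f : X → Y) {L : NNReal}
    (hf : LipschitzWith L f) {A : Set X} (hA : μH[(finrank ℝ Y : ℝ)] A ≠ ⊤)
    (hun : ∀ S ⊆ A, ∀ c : ℝ, 0 < c → (∀ x ∈ S, ∀ y ∈ S, c * dist x y ≤ dist (f x) (f y)) →
      μH[(finrank ℝ Y : ℝ)] S = 0)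
    {s δ ε : ℝ} (hs : 0 < s) (hs1 : s ≤ 1) (hδ : 0 < δ) (hε : 0 ≤ ε)
    (hεL : 2 * ε * (40 * (L + 1)) ^ finrank ℝ Y ≤ 1 / 2)
    (hcone : ∀ a ∈ A, ∀ r, 0 < r → r < δ →
      μH[(finrank ℝ Y : ℝ)] {x | dist x a < r ∧ dist (f x) (f a) < s * dist x a} ≤
        ENNReal.ofReal (ε * (r * s) ^ finrank ℝ Y)) :
    μH[(finrank ℝ Y : ℝ)] A = 0 := by
  set d := finrank ℝ Y with hd
  by_contra hne
  have hlt : μH[(d : ℝ)] A < 2 * μH[(d : ℝ)] A := by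
    rw [two_mul]; exact ENNReal.lt_add_right hA hne
  have hle := (le_iSup₂_of_le (ENNReal.ofReal (δ / 3)) (ENNReal.ofReal_pos.2 (by positivity))
    le_rfl).trans_eq (Measure.hausdorffMeasure_apply (d : ℝ) A).symm
  obtain ⟨t, ht⟩ := iInf_lt_iff.1 (lt_of_le_of_lt hle hlt)
  obtain ⟨hAt, ht⟩ := iInf_lt_iff.1 ht
  obtain ⟨hdiam, ht⟩ := iInf_lt_iff.1 ht
  have hpiece : ∀ n, μH[(d : ℝ)] (A ∩ t n) ≤
      2⁻¹ * ⨆ _ : (t n).Nonempty, ediam (t n) ^ (d : ℝ) := by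
    intro n
    rcases (t n).eq_empty_or_nonempty with h | hn
    · simp [h]
    have hfin : ediam (t n) ≠ ⊤ := ((hdiam n).trans_lt ENNReal.ofReal_lt_top).ne
    have hDle : (ediam (t n)).toReal ≤ δ / 3 :=
      ENNReal.toReal_le_of_le_ofReal (by positivity) (hdiam n)
    have := measure_le_diam_pow_of_cone μH[(d : ℝ)] f hf (Q := A ∩ t n)
      (fun S hS c hc h => hun S (hS.trans inter_subset_left) c hc h) hs hs1 hε
      (D := (ediam (t n)).toReal) (δ := δ) (by linarith)
      (fun x hx y hy => by
        rw [dist_edist]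
        exact ENNReal.toReal_mono hfin (edist_le_ediam_of_mem hx.2 hy.2))
      (fun a ha r hr hrδ => (measure_mono inter_subset_right).trans (hcone a ha.1 r hr hrδ))
    refine this.trans ?_
    rw [ciSup_pos hn, ENNReal.ofReal_mul (by positivity),
      ENNReal.ofReal_pow ENNReal.toReal_nonneg, ENNReal.ofReal_toReal hfin, ENNReal.rpow_natCast]
    gcongr
    refine (ENNReal.ofReal_le_ofReal hεL).trans_eq ?_
    rw [one_div, ENNReal.ofReal_inv_of_pos (by norm_num)]; simp
  have : μH[(d : ℝ)] A < μH[(d : ℝ)] A := by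
    calc μH[(d : ℝ)] A ≤ μH[(d : ℝ)] (⋃ n, A ∩ t n) := by
          apply measure_mono; rw [← inter_iUnion]; exact subset_inter le_rfl hAt
      _ ≤ ∑' n, μH[(d : ℝ)] (A ∩ t n) := measure_iUnion_le _
      _ ≤ ∑' n, 2⁻¹ * ⨆ _ : (t n).Nonempty, ediam (t n) ^ (d : ℝ) :=
          ENNReal.tsum_le_tsum hpiece
      _ = 2⁻¹ * ∑' n, ⨆ _ : (t n).Nonempty, ediam (t n) ^ (d : ℝ) := ENNReal.tsum_mul_left
      _ < 2⁻¹ * (2 * μH[(d : ℝ)] A) := ENNReal.mul_lt_mul_right (by simp) (by simp) ht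
      _ = μH[(d : ℝ)] A := by
          rw [← mul_assoc, ENNReal.inv_mul_cancel (by simp) (by simp), one_mul]
  exact lt_irrefl _ this

end Cones

section Images

variable {X : Type*} [MetricSpace X] [MeasurableSpace X] [BorelSpace X]
  {Y : Type*} [NormedAddCommGroup Y] [NormedSpace ℝ Y] [FiniteDimensional ℝ Y]
  [MeasurableSpace Y] [BorelSpace Y]

/-- Almost every point has finite upper density with respect to a finite measure, along dyadic
radii. -/
theorem ae_exists_measure_closedBall_le (ρ ν : Measure Y) [IsFiniteMeasure ρ] [ν.IsAddHaarMeasure] :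
    ∀ᵐ y ∂ν, ∃ N : ℕ, ∀ j ≥ N,
      ρ (closedBall y ((1 / 2) ^ j)) ≤ ENNReal.ofReal (N * ((1 / 2) ^ j) ^ finrank ℝ Y) := by
  set c := ν (closedBall 0 1) with hc
  have hctop : c ≠ ⊤ := measure_closedBall_lt_top.ne
  filter_upwards [Besicovitch.ae_tendsto_rnDeriv ρ ν, Measure.rnDeriv_lt_top ρ ν] with y hy hytop
  obtain ⟨q, hq, hq'⟩ := ENNReal.lt_iff_exists_nnreal_btwn.1 hytop
  have hpow : Tendsto (fun j : ℕ => ((1 : ℝ) / 2) ^ j) atTop (𝓝[>] 0) := by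
    refine tendsto_nhdsWithin_iff.2 ⟨tendsto_pow_atTop_nhds_zero_of_lt_one (by norm_num)
      (by norm_num), Eventually.of_forall fun j => ?_⟩
    simp only [mem_Ioi]; positivity
  have hev := (hy.comp hpow).eventually (gt_mem_nhds hq)
  obtain ⟨N₁, hN₁⟩ := eventually_atTop.1 hev
  obtain ⟨N₂, hN₂⟩ := exists_nat_ge (q * c.toReal)
  refine ⟨max N₁ N₂, fun j hj => ?_⟩
  have h1 := hN₁ j ((le_max_left _ _).trans hj)
  have hpos : (0 : ℝ) < (1 / 2) ^ j := by positivity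
  have h2 := (ENNReal.div_lt_iff (Or.inl (measure_closedBall_pos ν y hpos).ne')
      (Or.inl measure_closedBall_lt_top.ne)).1 h1
  refine h2.le.trans ?_
  rw [Measure.addHaar_closedBall' ν y hpos.le, ← hc, ← ENNReal.ofReal_toReal hctop,
    ← ENNReal.ofReal_coe_nnreal, ← ENNReal.ofReal_mul (by positivity),
    ← ENNReal.ofReal_mul (by positivity)]
  refine ENNReal.ofReal_le_ofReal ?_
  have : (q : ℝ) * c.toReal ≤ (max N₁ N₂ : ℕ) := hN₂.trans (by exact_mod_cast le_max_right _ _)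
  calc (q : ℝ) * (((1 / 2) ^ j) ^ finrank ℝ Y * c.toReal)
      = (q * c.toReal) * ((1 / 2) ^ j) ^ finrank ℝ Y := by ring
    _ ≤ _ := by gcongr

/-- A Lipschitz map on a space of finite `d`-dimensional Hausdorff measure has finite fibers over
`μH[d]`-almost every point. -/
theorem hausdorffMeasure_infinite_fiber_eq_zero [SecondCountableTopology X] {Z : Type*}
    [MetricSpace Z] [MeasurableSpace Z] [BorelSpace Z] {d : ℝ} (hd : 0 ≤ d)
    (hX : μH[d] (univ : Set X) ≠ ⊤) {f : X → Z} {L : NNReal} (hf : LipschitzWith L f) :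
    μH[d] {y | (f ⁻¹' {y}).Infinite} = 0 := by
  set H := (L : ℝ≥0∞) ^ d * μH[d] (univ : Set X) with hH
  have hHtop : H ≠ ⊤ := ENNReal.mul_ne_top (ENNReal.rpow_ne_top_of_nonneg hd (by simp)) hX
  -- `S N k` collects the points whose fiber has `N` points with mutual distances at least `1/(k+1)`
  let S : ℕ → ℕ → Set Z := fun N k => {y | ∃ F : Finset X, F.card = N ∧ (∀ x ∈ F, f x = y) ∧
    ∀ x ∈ F, ∀ x' ∈ F, x ≠ x' → 1 / ((k : ℝ) + 1) ≤ dist x x'}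
  have hS : ∀ N k : ℕ, (N : ℝ≥0∞) * μH[d] (S N k) ≤ H := by
    intro N k
    have hk : (0 : ℝ) < 1 / (2 * ((k : ℝ) + 1)) := by positivity
    obtain ⟨D, hDc, hDd⟩ := TopologicalSpace.exists_countable_dense X
    rcases D.eq_empty_or_nonempty with hDe | hDne
    · have hXe : IsEmpty X := by
        rw [hDe] at hDd
        exact ⟨fun x => by simpa using hDd x⟩
      rcases Nat.eq_zero_or_pos N with rfl | hN
      · simp
      · have : S N k = ∅ := by
          refine eq_empty_of_forall_notMem ?_
          rintro y ⟨F, hF, -⟩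
          rw [Finset.eq_empty_of_isEmpty F] at hF
          simp at hF; omega
        simp [this]
    obtain ⟨u, rfl⟩ := hDc.exists_eq_range hDne
    let Q : ℕ → Set X := disjointed fun i => ball (u i) (1 / (2 * ((k : ℝ) + 1)))
    have hQm : ∀ i, MeasurableSet (Q i) := fun i =>
      MeasurableSet.disjointed (fun _ => measurableSet_ball) i
    have hQcov : ∀ x, ∃ i, x ∈ Q i := by
      intro x
      have : x ∈ ⋃ i, Q i := by
        rw [iUnion_disjointed]
        obtain ⟨_, hi, i, rfl⟩ := Metric.dense_iff.1 hDd x _ hk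
        exact mem_iUnion.2 ⟨i, mem_ball_comm.1 hi⟩
      simpa using this
    choose ι hι using hQcov
    have hQd : ∀ x x', ι x = ι x' → dist x x' < 1 / ((k : ℝ) + 1) := by
      intro x x' h
      have h1 := disjointed_subset _ _ (hι x)
      have h2 := disjointed_subset _ _ (hι x')
      rw [← h] at h2
      calc dist x x' ≤ dist x (u (ι x)) + dist x' (u (ι x)) := dist_triangle_right _ _ _
        _ < 1 / (2 * ((k : ℝ) + 1)) + 1 / (2 * ((k : ℝ) + 1)) := add_lt_add h1 h2
        _ = 1 / ((k : ℝ) + 1) := by field_simp; norm_num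
    let g : Z → ℝ≥0∞ := fun y =>
      ∑' i, (toMeasurable μH[d] (f '' Q i)).indicator (1 : Z → ℝ≥0∞) y
    have hg : Measurable g := Measurable.tsum fun i =>
      measurable_one.indicator (measurableSet_toMeasurable _ _)
    have hSg : S N k ⊆ {y | (N : ℝ≥0∞) ≤ g y} := by
      rintro y ⟨F, hFc, hFy, hFd⟩
      have hinj : Set.InjOn ι F := by
        intro x hx x' hx' h
        by_contra hne
        exact absurd (hQd x x' h) (not_lt.2 (hFd x hx x' hx' hne))
      calc (N : ℝ≥0∞) = ∑ _x ∈ F, (1 : ℝ≥0∞) := by simp [hFc]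
        _ = ∑ x ∈ F, (toMeasurable μH[d] (f '' Q (ι x))).indicator (1 : Z → ℝ≥0∞) y := by
            refine Finset.sum_congr rfl fun x hx => ?_
            rw [indicator_of_mem]
            · rfl
            · exact subset_toMeasurable _ _ ⟨x, hι x, hFy x hx⟩
        _ = ∑ i ∈ F.image ι, (toMeasurable μH[d] (f '' Q i)).indicator (1 : Z → ℝ≥0∞) y := by
            rw [Finset.sum_image hinj]
        _ ≤ g y := ENNReal.sum_le_tsum _
    calc (N : ℝ≥0∞) * μH[d] (S N k) ≤ N * μH[d] {y | (N : ℝ≥0∞) ≤ g y} := by gcongr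
      _ ≤ ∫⁻ y, g y ∂μH[d] := mul_meas_ge_le_lintegral hg _
      _ = ∑' i, μH[d] (f '' Q i) := by
          rw [lintegral_tsum fun i =>
            (measurable_one.indicator (measurableSet_toMeasurable _ _)).aemeasurable]
          refine tsum_congr fun i => ?_
          rw [lintegral_indicator_one (measurableSet_toMeasurable _ _), measure_toMeasurable]
      _ ≤ ∑' i, (L : ℝ≥0∞) ^ d * μH[d] (Q i) :=
          ENNReal.tsum_le_tsum fun i => hf.hausdorffMeasure_image_le hd _
      _ = (L : ℝ≥0∞) ^ d * μH[d] (⋃ i, Q i) := by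
          rw [ENNReal.tsum_mul_left, measure_iUnion (disjoint_disjointed _) hQm]
      _ ≤ H := by rw [hH]; gcongr; exact subset_univ _
  have hmono : ∀ N, Monotone (S N) := by
    rintro N k k' hkk y ⟨F, hFc, hFy, hFd⟩
    refine ⟨F, hFc, hFy, fun x hx x' hx' hne => le_trans ?_ (hFd x hx x' hx' hne)⟩
    gcongr
  have hsub : ∀ N, {y | (f ⁻¹' {y}).Infinite} ⊆ ⋃ k, S N k := by
    intro N y hy
    obtain ⟨F, hFs, hFc⟩ := Set.Infinite.exists_subset_card_eq hy N
    obtain ⟨k, hk⟩ : ∃ k : ℕ, ∀ p ∈ F ×ˢ F, p.1 ≠ p.2 → 1 / ((k : ℝ) + 1) ≤ dist p.1 p.2 := by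
      have : ∀ p ∈ F ×ˢ F, ∀ᶠ k : ℕ in atTop, p.1 ≠ p.2 → 1 / ((k : ℝ) + 1) ≤ dist p.1 p.2 := by
        intro p _
        by_cases h : p.1 = p.2
        · simp [h]
        · filter_upwards [tendsto_one_div_add_atTop_nhds_zero_nat.eventually
            (gt_mem_nhds (dist_pos.2 h))] with k hk _ using hk.le
      exact ((eventually_all_finset (F ×ˢ F)).2 this).exists
    refine mem_iUnion.2 ⟨k, F, hFc, fun x hx => hFs hx, fun x hx x' hx' hne => ?_⟩
    exact hk (x, x') (Finset.mem_product.2 ⟨hx, hx'⟩) hne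
  have hall : ∀ N : ℕ, (N : ℝ≥0∞) * μH[d] {y | (f ⁻¹' {y}).Infinite} ≤ H := by
    intro N
    calc (N : ℝ≥0∞) * μH[d] {y | (f ⁻¹' {y}).Infinite} ≤ N * μH[d] (⋃ k, S N k) := by
          gcongr; exact hsub N
      _ = ⨆ k, N * μH[d] (S N k) := by rw [(hmono N).measure_iUnion, ENNReal.mul_iSup]
      _ ≤ H := iSup_le (hS N)
  by_contra hne
  obtain ⟨N, hN⟩ := ENNReal.exists_nat_mul_gt hne hHtop
  exact absurd (hall N) (not_le.2 hN)

end Images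

section Families

variable {W X Y : Type*} [MetricSpace X]

/-- The points `x` with `(x, a) ∈ R` in the cone of radius `r` and aperture `s` around the fiber of
`P lam` through `a`. -/
def coneSet [Dist Y] (P : W → X → Y) (R : Set (X × X)) (r s : ℝ) (lam : W) (a : X) : Set X :=
  {x | (x, a) ∈ R ∧ dist x a < r ∧ dist (P lam x) (P lam a) < s * dist x a}

/-- The cones at `a` with small dyadic radius and aperture have small measure. -/
def SmallCones [Dist Y] [MeasurableSpace X] (μ : Measure X) (P : W → X → Y) (R : Set (X × X))
    (d : ℕ) (ε : ℝ) (lam : W) (a : X) : Prop :=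
  ∃ N : ℕ, ∀ i ≥ N, ∀ j ≥ N, μ (coneSet P R ((1 / 2) ^ i) ((1 / 2) ^ j) lam a) ≤
    ENNReal.ofReal (ε * ((1 / 2) ^ i * (1 / 2) ^ j) ^ d)

/-- The image of `μ` under `P lam` has upper density at most `N` at `P lam a`, at dyadic scales
up to `2⁻ᴺ`. -/
def DensityLE {X : Type*} [Dist Y] [MeasurableSpace X] (μ : Measure X) (P : W → X → Y) (d N : ℕ)
    (lam : W) (a : X) : Prop :=
  ∀ j ≥ N, μ {x | dist (P lam x) (P lam a) ≤ (1 / 2) ^ j} ≤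
    ENNReal.ofReal (N * ((1 / 2) ^ j) ^ d)

/-- The fiber of `P lam` through `a` has no other point in the ball of radius `2⁻ᴺ` around `a`. -/
def IsolatedInFiber (P : W → X → Y) (N : ℕ) (lam : W) (a : X) : Prop :=
  ∀ x, dist x a ≤ (1 / 2) ^ N → P lam x = P lam a → x = a

section Measurability

variable [MeasurableSpace W] [MeasurableSpace X] [PseudoMetricSpace Y] [MeasurableSpace Y]
  [BorelSpace Y] [SecondCountableTopology Y] {P : W → X → Y}

theorem measurableSet_densityLE {X : Type*} [MeasurableSpace X] {P : W → X → Y}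
    (hPm : Measurable (Function.uncurry P)) (μ : Measure X) [SFinite μ] (d N : ℕ) :
    MeasurableSet {p : W × X | DensityLE μ P d N p.1 p.2} := by
  have key : ∀ r : ℝ, Measurable fun p : W × X => μ {x | dist (P p.1 x) (P p.1 p.2) ≤ r} := by
    intro r
    have hx : Measurable fun q : (W × X) × X => P q.1.1 q.2 :=
      hPm.comp (measurable_fst.fst.prodMk measurable_snd)
    have ha : Measurable fun q : (W × X) × X => P q.1.1 q.1.2 :=
      hPm.comp (measurable_fst.fst.prodMk measurable_fst.snd)
    exact measurable_measure_prodMk_left (measurableSet_le (hx.dist ha) measurable_const)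
  simp only [DensityLE, ofPred_forall]
  exact MeasurableSet.iInter fun j => MeasurableSet.iInter fun _ =>
      measurableSet_le (key _) measurable_const

variable [BorelSpace X] [SecondCountableTopology X]

theorem measurableSet_smallCones (hPm : Measurable (Function.uncurry P)) (μ : Measure X) [SFinite μ]
    {R : Set (X × X)} (hR : MeasurableSet R) (d : ℕ) (ε : ℝ) :
    MeasurableSet {p : W × X | SmallCones μ P R d ε p.1 p.2} := by
  have key : ∀ r s : ℝ, Measurable fun p : W × X => μ (coneSet P R r s p.1 p.2) := by
    intro r s
    have hx : Measurable fun q : (W × X) × X => P q.1.1 q.2 :=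
      hPm.comp (measurable_fst.fst.prodMk measurable_snd)
    have ha : Measurable fun q : (W × X) × X => P q.1.1 q.1.2 :=
      hPm.comp (measurable_fst.fst.prodMk measurable_fst.snd)
    have hdist : Measurable fun q : (W × X) × X => dist q.2 q.1.2 :=
      measurable_snd.dist measurable_fst.snd
    have hset : MeasurableSet {q : (W × X) × X | (q.2, q.1.2) ∈ R ∧ dist q.2 q.1.2 < r ∧
        dist (P q.1.1 q.2) (P q.1.1 q.1.2) < s * dist q.2 q.1.2} :=
      ((measurable_snd.prodMk measurable_fst.snd) hR).inter
        ((measurableSet_lt hdist measurable_const).inter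
          (measurableSet_lt (hx.dist ha) (hdist.const_mul s)))
    exact measurable_measure_prodMk_left hset
  simp only [SmallCones, ofPred_exists, ofPred_forall]
  exact MeasurableSet.iUnion fun N => MeasurableSet.iInter fun i => MeasurableSet.iInter fun _ =>
    MeasurableSet.iInter fun j => MeasurableSet.iInter fun _ =>
      measurableSet_le (key _ _) measurable_const

theorem measurableSet_isolatedInFiber {Y : Type*} [MetricSpace Y] [MeasurableSpace Y] [BorelSpace Y]
    [SecondCountableTopology Y] {P : W → X → Y} [CompactSpace X]
    (hPm : Measurable (Function.uncurry P)) (hPc : ∀ lam, Continuous (P lam)) (N : ℕ) :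
    MeasurableSet {p : W × X | IsolatedInFiber P N p.1 p.2} := by
  obtain ⟨D, hDc, hDd⟩ := TopologicalSpace.exists_countable_dense X
  -- `φ k p x ≤ 0` says that `x` witnesses the failure of the property at distance `≥ 2⁻ᵏ`
  let φ : ℕ → W × X → X → ℝ := fun k p x =>
    max (dist (P p.1 x) (P p.1 p.2)) (max ((1 / 2) ^ k - dist x p.2) (dist x p.2 - (1 / 2) ^ N))
  have hφ : ∀ k p, Continuous (φ k p) := by
    intro k p
    have := hPc p.1
    fun_prop
  have heq : {p : W × X | IsolatedInFiber P N p.1 p.2} =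
      (⋃ k : ℕ, ⋂ j : ℕ, ⋃ q ∈ D, {p | φ k p q < 1 / ((j : ℝ) + 1)})ᶜ := by
    ext p
    simp only [mem_ofPred_eq, mem_compl_iff, mem_iUnion, mem_iInter, exists_prop]
    rw [← not_iff_not, not_not]
    constructor
    · intro h
      simp only [IsolatedInFiber, not_forall] at h
      obtain ⟨x, hx, hPx, hne⟩ := h
      obtain ⟨k, hk⟩ := exists_pow_lt_of_lt_one (dist_pos.2 hne) (show (1 / 2 : ℝ) < 1 by norm_num)
      refine ⟨k, fun j => ?_⟩
      have hj : (0 : ℝ) < 1 / ((j : ℝ) + 1) := by positivity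
      have hφx : φ k p x < 1 / ((j : ℝ) + 1) :=
        max_lt (by rw [hPx, dist_self]; exact hj) (max_lt (by linarith) (by linarith))
      obtain ⟨q, hq, hqD⟩ := hDd.inter_open_nonempty _
        (isOpen_lt (hφ k p) continuous_const) ⟨x, hφx⟩
      exact ⟨q, hqD, hq⟩
    · rintro ⟨k, hk⟩ hiso
      obtain ⟨q₀, -, -⟩ := hk 0
      obtain ⟨x, -, hx⟩ := isCompact_univ.exists_isMinOn ⟨q₀, mem_univ _⟩ (hφ k p).continuousOn
      have hle : φ k p x ≤ 0 := by
        refine ge_of_tendsto' tendsto_one_div_add_atTop_nhds_zero_nat fun j => ?_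
        obtain ⟨q, -, hq⟩ := hk j
        exact ((isMinOn_iff.1 hx) q (mem_univ _)).trans hq.le
      have h1 : dist (P p.1 x) (P p.1 p.2) ≤ 0 := (le_max_left _ _).trans hle
      have h2 := (max_le_iff.1 ((le_max_right _ _).trans hle))
      have hxa := hiso x (by linarith [h2.2]) (dist_le_zero.1 h1)
      have h3 := h2.1
      rw [hxa, dist_self] at h3
      have : (0 : ℝ) < (1 / 2) ^ k := by positivity
      linarith
  rw [heq]
  refine (MeasurableSet.iUnion fun k => MeasurableSet.iInter fun j =>
    MeasurableSet.biUnion hDc fun q _ => measurableSet_lt ?_ measurable_const).compl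
  have hx : Measurable fun p : W × X => P p.1 q :=
    hPm.comp (measurable_fst.prodMk measurable_const)
  have hd : Measurable fun p : W × X => dist q p.2 := measurable_const.dist measurable_snd
  exact (hx.dist hPm).max ((measurable_const.sub hd).max (hd.sub measurable_const))

end Measurability

end Families

section Slices

variable {W X Y : Type*} [NormedAddCommGroup W] [NormedSpace ℝ W] [MetricSpace X]
  [NormedAddCommGroup Y] [NormedSpace ℝ Y]

/-- The pairs `(x, a)` for which `t ↦ (P (lam + J t) x - P (lam + J t) a) / dist x a` is close to
a translation as long as `lam + J t` stays in `B`. -/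
def transversalPairs (P : W → X → Y) (B : Set W) (J : Y →L[ℝ] W) : Set (X × X) :=
  {p | ∀ lam ∈ B, ∀ t, lam + J t ∈ B →
    ‖(P (lam + J t) p.1 - P (lam + J t) p.2) - (P lam p.1 - P lam p.2) - dist p.1 p.2 • t‖ ≤
      1 / 2 * dist p.1 p.2 * ‖t‖}

theorem isClosed_transversalPairs {P : W → X → Y} (hP : ∀ lam, Continuous (P lam)) (B : Set W)
    (J : Y →L[ℝ] W) : IsClosed (transversalPairs P B J) := by
  simp only [transversalPairs, ofPred_forall]
  refine isClosed_biInter fun lam _ => isClosed_iInter fun t => isClosed_iInter fun _ => ?_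
  have h1 := hP lam
  have h2 := hP (lam + J t)
  exact isClosed_le (by fun_prop) (by fun_prop)

theorem exists_zero_of_close_to_translation {Y : Type*} [NormedAddCommGroup Y] [NormedSpace ℝ Y]
    [CompleteSpace Y] {G : Y → Y} {b : Y} {σ : ℝ} (hσ : 0 ≤ σ)
    (hG : ∀ t ∈ closedBall b σ, ∀ t' ∈ closedBall b σ,
      ‖G t - G t' - (t - t')‖ ≤ 1 / 2 * ‖t - t'‖) (hb : ‖G b‖ ≤ σ / 2) :
    ∃ t ∈ closedBall b σ, G t = 0 := by
  have happ : ApproximatesLinearOn G (ContinuousLinearMap.id ℝ Y) (closedBall b σ) (1 / 2) := by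
    intro t ht t' ht'
    simpa using hG t ht t' ht'
  let inv : (ContinuousLinearMap.id ℝ Y).NonlinearRightInverse :=
    { toFun := id
      nnnorm := 1
      bound' := fun y => by simp
      right_inv' := fun y => rfl }
  refine happ.surjOn_closedBall_of_nonlinearRightInverse inv hσ le_rfl ?_
  have hinv : inv.nnnorm = 1 := rfl
  rw [mem_closedBall, dist_comm, dist_zero_right, hinv]
  refine hb.trans (le_of_eq ?_)
  norm_num
  ring

end Slices

section SliceEstimate

variable {W X Y : Type*} [NormedAddCommGroup W] [NormedSpace ℝ W] [MetricSpace X]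
  [NormedAddCommGroup Y] [NormedSpace ℝ Y]

theorem norm_sub_sub_smul_le_of_mem_transversalPairs {P : W → X → Y} {B : Set W} {J : Y →L[ℝ] W}
    {x a : X} (h : (x, a) ∈ transversalPairs P B J) {lam : W} {t t' : Y} (ht : lam + J t ∈ B)
    (htB : lam + J t' ∈ B) :
    ‖(P (lam + J t') x - P (lam + J t') a) - (P (lam + J t) x - P (lam + J t) a) -
      dist x a • (t' - t)‖ ≤ 1 / 2 * dist x a * ‖t' - t‖ := by
  have key := h (lam + J t) ht (t' - t)
  have e : lam + J t + J (t' - t) = lam + J t' := by rw [map_sub]; abel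
  rw [e] at key
  exact key htB

/-- The set of points `x` near `a` for which `P (lam₀ + J t) x = P (lam₀ + J t) a` for some `t`
in a given set, as an outer measure in the latter. -/
noncomputable def hittingMeasure [MeasurableSpace X] (μ : Measure X) (P : W → X → Y) (B : Set W)
    (J : Y →L[ℝ] W) (lam₀ : W) (a : X) (r : ℝ) : OuterMeasure Y :=
  OuterMeasure.map Prod.snd (OuterMeasure.restrict
    {p : X × Y | (p.1, a) ∈ transversalPairs P B J ∧ p.1 ≠ a ∧ dist p.1 a < r ∧
      lam₀ + J p.2 ∈ B ∧ P (lam₀ + J p.2) p.1 = P (lam₀ + J p.2) a}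
    (OuterMeasure.comap Prod.fst μ.toOuterMeasure))

theorem hittingMeasure_apply [MeasurableSpace X] (μ : Measure X) (P : W → X → Y) (B : Set W)
    (J : Y →L[ℝ] W) (lam₀ : W) (a : X) (r : ℝ) (D : Set Y) :
    hittingMeasure μ P B J lam₀ a r D = μ {x | (x, a) ∈ transversalPairs P B J ∧ x ≠ a ∧
      dist x a < r ∧ ∃ t ∈ D, lam₀ + J t ∈ B ∧ P (lam₀ + J t) x = P (lam₀ + J t) a} := by
  rw [hittingMeasure, OuterMeasure.map_apply, OuterMeasure.restrict_apply,
    OuterMeasure.comap_apply, Measure.coe_toOuterMeasure]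
  congr 1
  ext x
  simp only [mem_image, mem_inter_iff, mem_preimage, mem_ofPred_eq, Prod.exists, exists_and_right,
    exists_eq_right]
  grind

theorem hittingMeasure_eq_zero [MeasurableSpace X] (μ : Measure X) {P : W → X → Y} (B : Set W)
    (J : Y →L[ℝ] W) (lam₀ : W) (a : X) {N i : ℕ} (hi : N ≤ i) {D : Set Y}
    (hD : ∀ t ∈ D, IsolatedInFiber P N (lam₀ + J t) a) :
    hittingMeasure μ P B J lam₀ a ((1 / 2) ^ i) D = 0 := by
  rw [hittingMeasure_apply]
  convert measure_empty (μ := μ)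
  rw [eq_empty_iff_forall_notMem]
  rintro x ⟨-, hne, hx, t, ht, -, hPt⟩
  have : ((1 / 2 : ℝ)) ^ i ≤ (1 / 2) ^ N :=
    pow_le_pow_of_le_one (by norm_num) (by norm_num) hi
  exact hne (hD t ht x (hx.le.trans this) hPt)

theorem hittingMeasure_closedBall_le [MeasurableSpace X] (μ : Measure X) {P : W → X → Y} (B : Set W)
    (J : Y →L[ℝ] W) (lam₀ : W) (a : X) {d N i : ℕ} (hi : N ≤ i) {t : Y} (ht : lam₀ + J t ∈ B)
    (hdens : DensityLE μ P d N (lam₀ + J t) a) {s : ℝ} (hs : 0 < s) (hs1 : s ≤ 1 / 2) :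
    hittingMeasure μ P B J lam₀ a ((1 / 2) ^ i) (closedBall t s) ≤
      ENNReal.ofReal (N * 3 ^ d * s ^ d * ((1 / 2) ^ i) ^ d) := by
  have hi0 : (0 : ℝ) < (1 / 2) ^ i := by positivity
  have hiN : ((1 / 2 : ℝ)) ^ i ≤ (1 / 2) ^ N :=
    pow_le_pow_of_le_one (by norm_num) (by norm_num) hi
  have hi1 : ((1 / 2 : ℝ)) ^ i ≤ 1 := pow_le_one₀ (by norm_num) (by norm_num)
  set ρ : ℝ := 3 / 2 * s * (1 / 2) ^ i with hρ
  have hρ0 : 0 < ρ := by positivity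
  have hρi : ρ ≤ 3 / 4 * (1 / 2) ^ i := by
    rw [hρ]; gcongr; linarith
  obtain ⟨n, hn, hn'⟩ := exists_nat_pow_near_of_lt_one hρ0 (by linarith)
    (show (0 : ℝ) < 1 / 2 by norm_num) (by norm_num)
  have hNn : N ≤ n := by
    by_contra hlt
    push Not at hlt
    have h1 : ((1 / 2 : ℝ)) ^ N ≤ (1 / 2) ^ (n + 1) :=
      pow_le_pow_of_le_one (by norm_num) (by norm_num) hlt
    linarith
  rw [hittingMeasure_apply]
  calc μ _ ≤ μ {x | dist (P (lam₀ + J t) x) (P (lam₀ + J t) a) ≤ (1 / 2) ^ n} := by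
        refine measure_mono ?_
        rintro x ⟨hx, -, hxa, t', ht', hB', hP'⟩
        have h := norm_sub_sub_smul_le_of_mem_transversalPairs hx ht hB'
        rw [hP', sub_self] at h
        rw [mem_closedBall, dist_eq_norm] at ht'
        have hd0 : 0 ≤ dist x a := dist_nonneg
        refine le_trans ?_ hn'
        rw [dist_eq_norm]
        have h2 : ‖P (lam₀ + J t) x - P (lam₀ + J t) a‖ ≤
            1 / 2 * dist x a * ‖t' - t‖ + dist x a * ‖t' - t‖ := by
          have h3 : ‖dist x a • (t' - t)‖ = dist x a * ‖t' - t‖ := by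
            rw [norm_smul, Real.norm_of_nonneg hd0]
          have h4 : P (lam₀ + J t) x - P (lam₀ + J t) a =
            -((0 - (P (lam₀ + J t) x - P (lam₀ + J t) a) - dist x a • (t' - t)) +
              dist x a • (t' - t)) := by abel
          rw [h4, norm_neg]
          exact (norm_add_le _ _).trans (add_le_add h h3.le)
        calc _ ≤ 3 / 2 * (‖t' - t‖ * dist x a) := by linarith
          _ ≤ 3 / 2 * (s * (1 / 2) ^ i) := by gcongr
          _ = ρ := by rw [hρ]; ring
    _ ≤ ENNReal.ofReal (N * ((1 / 2) ^ n) ^ d) := hdens n hNn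
    _ ≤ ENNReal.ofReal (N * (3 * s * (1 / 2) ^ i) ^ d) := by
        gcongr
        rw [pow_succ] at hn
        linarith
    _ = _ := by rw [mul_pow, mul_pow]; ring_nf

theorem measure_coneSet_le_hittingMeasure [CompleteSpace Y] [MeasurableSpace X] (μ : Measure X)
    {P : W → X → Y} {B : Set W} {J : Y →L[ℝ] W} {lam₀ : W} (a : X) (r : ℝ) {t : Y} {s : ℝ}
    (hs : 0 < s) (hB : ∀ t' ∈ closedBall t (2 * s), lam₀ + J t' ∈ B) :
    μ (coneSet P (transversalPairs P B J) r s (lam₀ + J t) a) ≤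
      hittingMeasure μ P B J lam₀ a r (closedBall t (2 * s)) := by
  rw [hittingMeasure_apply]
  refine measure_mono ?_
  rintro x ⟨hx, hr, hcone⟩
  have hne : x ≠ a := by
    rintro rfl
    simp at hcone
  have hd : 0 < dist x a := dist_pos.2 hne
  refine ⟨hx, hne, hr, ?_⟩
  have hclose : ∀ u ∈ closedBall t (2 * s), ∀ u' ∈ closedBall t (2 * s),
      ‖(dist x a)⁻¹ • (P (lam₀ + J u) x - P (lam₀ + J u) a) -
        (dist x a)⁻¹ • (P (lam₀ + J u') x - P (lam₀ + J u') a) - (u - u')‖ ≤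
        1 / 2 * ‖u - u'‖ := by
    intro u hu u' hu'
    have h := norm_sub_sub_smul_le_of_mem_transversalPairs hx (hB u' hu') (hB u hu)
    have e : (dist x a)⁻¹ • (P (lam₀ + J u) x - P (lam₀ + J u) a) -
        (dist x a)⁻¹ • (P (lam₀ + J u') x - P (lam₀ + J u') a) - (u - u') =
        (dist x a)⁻¹ • ((P (lam₀ + J u) x - P (lam₀ + J u) a) -
          (P (lam₀ + J u') x - P (lam₀ + J u') a) - dist x a • (u - u')) := by
      rw [smul_sub _ (_ - _) (dist x a • _), smul_smul, inv_mul_cancel₀ hd.ne', one_smul,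
        ← smul_sub]
    rw [e, norm_smul, norm_inv, Real.norm_of_nonneg hd.le, inv_mul_le_iff₀ hd]
    linarith
  have hsmall : ‖(dist x a)⁻¹ • (P (lam₀ + J t) x - P (lam₀ + J t) a)‖ ≤ 2 * s / 2 := by
    rw [norm_smul, norm_inv, Real.norm_of_nonneg hd.le, inv_mul_le_iff₀ hd, ← dist_eq_norm]
    linarith
  obtain ⟨t', ht', h0⟩ := exists_zero_of_close_to_translation
    (G := fun t' => (dist x a)⁻¹ • (P (lam₀ + J t') x - P (lam₀ + J t') a)) (by positivity)
    hclose hsmall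
  refine ⟨t', ht', hB t' ht', ?_⟩
  rwa [smul_eq_zero_iff_right (inv_ne_zero hd.ne'), sub_eq_zero] at h0

variable [MeasurableSpace W] [BorelSpace W] [CompactSpace X] [MeasurableSpace X] [BorelSpace X]
  [FiniteDimensional ℝ Y] [MeasurableSpace Y] [BorelSpace Y]

/-- On almost every parameter of an affine slice, a point which is isolated in its fiber and at
which the image measure has finite density has small cones. -/
theorem ae_smallCones_slice (μ : Measure X) [SFinite μ] (ν : Measure Y) [ν.IsAddHaarMeasure]
    {P : W → X → Y} (hPm : Measurable (Function.uncurry P)) (hPc : ∀ lam, Continuous (P lam))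
    {B : Set W} (hB : IsOpen B) (J : Y →L[ℝ] W) (lam₀ : W) (a : X) (N : ℕ) {ε : ℝ} (hε : 0 < ε) :
    ∀ᵐ t ∂ν, lam₀ + J t ∈ B → DensityLE μ P (finrank ℝ Y) N (lam₀ + J t) a →
      IsolatedInFiber P N (lam₀ + J t) a →
      SmallCones μ P (transversalPairs P B J) (finrank ℝ Y) ε (lam₀ + J t) a := by
  set d := finrank ℝ Y
  have hγ : Continuous fun t => lam₀ + J t := by fun_prop
  have hγm : Measurable fun t => (lam₀ + J t, a) := hγ.measurable.prodMk measurable_const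
  let A : Set Y := {t | lam₀ + J t ∈ B ∧ DensityLE μ P d N (lam₀ + J t) a ∧
    IsolatedInFiber P N (lam₀ + J t) a}
  have hA : MeasurableSet A :=
    (hγ.measurable hB.measurableSet).inter ((hγm (measurableSet_densityLE hPm μ d N)).inter
      (hγm (measurableSet_isolatedInFiber hPm hPc N)))
  let c : ℕ → ℝ≥0∞ := fun i => ENNReal.ofReal (((1 / 2) ^ i) ^ d)
  have hc0 : ∀ i, c i ≠ 0 := fun i => (ENNReal.ofReal_pos.2 (by positivity)).ne'
  have hct : ∀ i, c i ≠ ⊤ := fun i => ENNReal.ofReal_ne_top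
  let Ψ : OuterMeasure Y :=
    ⨆ i : ℕ, (c (N + i))⁻¹ • hittingMeasure μ P B J lam₀ a ((1 / 2) ^ (N + i))
  have hΨ : ∀ D, Ψ D = ⨆ i : ℕ, (c (N + i))⁻¹ *
      hittingMeasure μ P B J lam₀ a ((1 / 2) ^ (N + i)) D := fun D => by
    simp only [Ψ, OuterMeasure.iSup_apply, _root_.smul_apply, smul_eq_mul]
  have hΨA : Ψ A = 0 := by
    simp only [hΨ, ENNReal.iSup_eq_zero]
    intro i
    rw [hittingMeasure_eq_zero μ B J lam₀ a (Nat.le_add_right N i) fun t ht => ht.2.2, mul_zero]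
  have hΨM : ∀ t ∈ A, ∀ s, 0 < s → s ≤ 1 / 2 →
      Ψ (closedBall t s) ≤ ENNReal.ofReal (N * 3 ^ d * s ^ d) := by
    intro t ht s hs hs1
    rw [hΨ]
    refine iSup_le fun i => ?_
    rw [ENNReal.inv_mul_le_iff (hc0 _) (hct _), mul_comm]
    refine (hittingMeasure_closedBall_le μ B J lam₀ a (Nat.le_add_right N i) ht.1 ht.2.1
      hs hs1).trans_eq ?_
    rw [ENNReal.ofReal_mul (by positivity)]
  have hε' : 0 < ε / 2 ^ d := by positivity
  filter_upwards [ae_outerMeasure_closedBall_le_of_eq_zero Ψ ν hA hΨA (by positivity)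
    (by norm_num) hΨM hε'] with t ht htB htD htI
  have hev := ht ⟨htB, htD, htI⟩
  have hBev : ∀ᶠ s in 𝓝[>] (0 : ℝ), ∀ t' ∈ closedBall t s, lam₀ + J t' ∈ B := by
    have hopen : {t' | lam₀ + J t' ∈ B} ∈ 𝓝 t := (hB.preimage hγ).mem_nhds htB
    obtain ⟨δ, hδ, hsub⟩ := Metric.nhds_basis_closedBall.mem_iff.1 hopen
    filter_upwards [Ioo_mem_nhdsGT hδ] with s hs t' ht'
    exact hsub (closedBall_subset_closedBall hs.2.le ht')
  have hlim : Tendsto (fun j : ℕ => 2 * (1 / 2 : ℝ) ^ j) atTop (𝓝[>] 0) := by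
    refine tendsto_nhdsWithin_iff.2 ⟨?_, Eventually.of_forall fun j => by
      rw [mem_Ioi]; positivity⟩
    simpa using (tendsto_pow_atTop_nhds_zero_of_lt_one (r := (1 / 2 : ℝ)) (by norm_num)
      (by norm_num)).const_mul 2
  obtain ⟨N', hN'⟩ := eventually_atTop.1 (hlim.eventually (hev.and hBev))
  refine ⟨max N N', fun i hi j hj => ?_⟩
  obtain ⟨h1, h2⟩ := hN' j (le_of_max_le_right hj)
  refine (measure_coneSet_le_hittingMeasure μ a _ (by positivity) h2).trans ?_
  obtain ⟨k, rfl⟩ := Nat.exists_eq_add_of_le (le_of_max_le_left hi)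
  have h3 := (le_iSup (fun i : ℕ => (c (N + i))⁻¹ * hittingMeasure μ P B J lam₀ a
    ((1 / 2) ^ (N + i)) (closedBall t (2 * (1 / 2) ^ j))) k).trans ((hΨ _).symm.le.trans h1)
  rw [ENNReal.inv_mul_le_iff (hc0 _) (hct _), ← ENNReal.ofReal_mul (by positivity)] at h3
  refine h3.trans_eq ?_
  congr 1
  rw [mul_pow 2, mul_pow _ _ d]
  field_simp
  rfl

end SliceEstimate

section Slicing

variable {W Y : Type*} [NormedAddCommGroup W] [NormedSpace ℝ W] [FiniteDimensional ℝ W]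
  [MeasurableSpace W] [BorelSpace W]
  [NormedAddCommGroup Y] [NormedSpace ℝ Y] [FiniteDimensional ℝ Y]
  [MeasurableSpace Y] [BorelSpace Y]

theorem ae_of_ae_slice (μ : Measure W) [μ.IsAddHaarMeasure] (ν : Measure Y) [ν.IsAddHaarMeasure]
    (J : Y →L[ℝ] W) {p : W → Prop} (hp : MeasurableSet {w | p w})
    (h : ∀ w, ∀ᵐ t ∂ν, p (w + J t)) : ∀ᵐ w ∂μ, p w := by
  have hmeas : MeasurableSet {q : W × Y | p (q.1 + J q.2)} :=
    (show Measurable fun q : W × Y => q.1 + J q.2 by fun_prop) hp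
  have h1 := (Measure.ae_ae_comm (μ := μ) (ν := ν) hmeas).1 (Eventually.of_forall h)
  obtain ⟨t, ht⟩ := h1.exists
  have h2 := (measurePreserving_add_right μ (-J t)).quasiMeasurePreserving.ae ht
  simpa using h2

end Slicing

section SmallConesUnion

variable {W X Y : Type*} [NormedAddCommGroup W] [NormedSpace ℝ W] [MetricSpace X]
  [NormedAddCommGroup Y] [NormedSpace ℝ Y] [MeasurableSpace X]

theorem DensityLE.mono {W X Y : Type*} [Dist Y] [MeasurableSpace X] {μ : Measure X}
    {P : W → X → Y} {d N N' : ℕ} {lam : W} {a : X} (h : DensityLE μ P d N lam a) (hN : N ≤ N') :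
    DensityLE μ P d N' lam a := fun j hj =>
  (h j (hN.trans hj)).trans (by gcongr)

theorem IsolatedInFiber.mono {W X Y : Type*} [MetricSpace X] {P : W → X → Y} {N N' : ℕ} {lam : W}
    {a : X} (h : IsolatedInFiber P N lam a) (hN : N ≤ N') : IsolatedInFiber P N' lam a :=
  fun x hx => h x (hx.trans (pow_le_pow_of_le_one (by norm_num) (by norm_num) hN))

theorem SmallCones.of_transversalPairs {μ : Measure X} {P : W → X → Y} {B : Set W}
    (𝒥 : Finset (Y →L[ℝ] W)) {c₀ : ℝ} (hc₀ : 0 < c₀) {lam : W} {a : X} {d : ℕ} {ε : ℝ}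
    (hε : 0 ≤ ε)
    (h𝒥 : ∀ x, x ≠ a → dist (P lam x) (P lam a) ≤ c₀ * dist x a →
      ∃ J ∈ 𝒥, (x, a) ∈ transversalPairs P B J)
    (h : ∀ J ∈ 𝒥, SmallCones μ P (transversalPairs P B J) d (ε / (𝒥.card + 1)) lam a) :
    SmallCones μ P univ d ε lam a := by
  choose! N hN using h
  obtain ⟨j₀, hj₀⟩ := exists_pow_lt_of_lt_one hc₀ (show (1 / 2 : ℝ) < 1 by norm_num)
  refine ⟨max j₀ (𝒥.sup N), fun i hi j hj => ?_⟩
  have hNi : ∀ J ∈ 𝒥, N J ≤ i := fun J hJ => (Finset.le_sup hJ).trans (le_of_max_le_right hi)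
  have hNj : ∀ J ∈ 𝒥, N J ≤ j := fun J hJ => (Finset.le_sup hJ).trans (le_of_max_le_right hj)
  have hsub : coneSet P univ ((1 / 2) ^ i) ((1 / 2) ^ j) lam a ⊆
      ⋃ J ∈ 𝒥, coneSet P (transversalPairs P B J) ((1 / 2) ^ i) ((1 / 2) ^ j) lam a := by
    rintro x ⟨-, hx, hcone⟩
    have hne : x ≠ a := by
      rintro rfl
      simp at hcone
    have hjc : (1 / 2 : ℝ) ^ j ≤ c₀ :=
      (pow_le_pow_of_le_one (by norm_num) (by norm_num) (le_of_max_le_left hj)).trans hj₀.le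
    obtain ⟨J, hJ, hJx⟩ := h𝒥 x hne (hcone.le.trans (by gcongr))
    exact mem_biUnion hJ ⟨hJx, hx, hcone⟩
  refine (measure_mono hsub).trans ((measure_biUnion_finset_le _ _).trans ?_)
  refine (Finset.sum_le_sum fun J hJ => hN J hJ i (hNi J hJ) j (hNj J hJ)).trans ?_
  rw [Finset.sum_const, nsmul_eq_mul, ← ENNReal.ofReal_natCast,
    ← ENNReal.ofReal_mul (by positivity)]
  refine ENNReal.ofReal_le_ofReal ?_
  rw [← mul_assoc]
  gcongr
  rw [mul_div_assoc', div_le_iff₀ (by positivity)]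
  nlinarith

variable [FiniteDimensional ℝ W] [MeasurableSpace W] [BorelSpace W]
  [CompactSpace X] [BorelSpace X] [FiniteDimensional ℝ Y] [MeasurableSpace Y] [BorelSpace Y]

theorem ae_smallCones (κ : Measure W) [κ.IsAddHaarMeasure] (μ : Measure X) [SFinite μ]
    {P : W → X → Y} (hPm : Measurable (Function.uncurry P)) (hPc : ∀ lam, Continuous (P lam))
    {B : Set W} (hB : IsOpen B) (J : Y →L[ℝ] W) (a : X) {ε : ℝ} (hε : 0 < ε) :
    ∀ᵐ lam ∂κ, lam ∈ B → (∃ N, DensityLE μ P (finrank ℝ Y) N lam a) →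
      (∃ N, IsolatedInFiber P N lam a) →
      SmallCones μ P (transversalPairs P B J) (finrank ℝ Y) ε lam a := by
  have hγ : Measurable fun lam : W => (lam, a) := measurable_id.prodMk measurable_const
  have key : ∀ N : ℕ, ∀ᵐ lam ∂κ, lam ∈ B → DensityLE μ P (finrank ℝ Y) N lam a →
      IsolatedInFiber P N lam a →
      SmallCones μ P (transversalPairs P B J) (finrank ℝ Y) ε lam a := by
    intro N
    refine ae_of_ae_slice κ Measure.addHaar J ?_ fun w =>
      ae_smallCones_slice μ Measure.addHaar hPm hPc hB J w a N hε
    exact hB.measurableSet.imp ((hγ (measurableSet_densityLE hPm μ _ N)).imp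
      ((hγ (measurableSet_isolatedInFiber hPm hPc N)).imp
        (hγ (measurableSet_smallCones hPm μ
          (isClosed_transversalPairs hPc B J).measurableSet _ ε))))
  filter_upwards [ae_all_iff.2 key] with lam hlam hlamB hD hI
  obtain ⟨N₁, hN₁⟩ := hD
  obtain ⟨N₂, hN₂⟩ := hI
  exact hlam (max N₁ N₂) hlamB (hN₁.mono (le_max_left _ _)) (hN₂.mono (le_max_right _ _))

end SmallConesUnion

section CompactFamilies

variable {W X Y : Type*} [MetricSpace X] [MeasurableSpace X] [BorelSpace X]
  [NormedAddCommGroup Y] [NormedSpace ℝ Y] [FiniteDimensional ℝ Y]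
  [MeasurableSpace Y] [BorelSpace Y]

theorem hausdorffMeasure_setOf_smallCones_eq_zero {P : W → X → Y} {lam : W} {L : NNReal}
    (hP : LipschitzWith L (P lam)) (hX : μH[(finrank ℝ Y : ℝ)] (univ : Set X) ≠ ⊤)
    (hun : ∀ Q : Set X, ∀ c : ℝ, 0 < c →
      (∀ x ∈ Q, ∀ y ∈ Q, c * dist x y ≤ dist (P lam x) (P lam y)) →
      μH[(finrank ℝ Y : ℝ)] Q = 0) {ε : ℝ} (hε : 0 ≤ ε)
    (hεL : 2 * (ε * 2 ^ finrank ℝ Y) * (40 * (L + 1)) ^ finrank ℝ Y ≤ 1 / 2) :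
    μH[(finrank ℝ Y : ℝ)]
      {a | SmallCones μH[(finrank ℝ Y : ℝ)] P univ (finrank ℝ Y) ε lam a} = 0 := by
  simp only [SmallCones, ofPred_exists]
  refine measure_iUnion_null fun N => ?_
  refine hausdorffMeasure_eq_zero_of_cone (P lam) hP (measure_ne_top_of_subset (subset_univ _) hX)
    (fun S _ => hun S) (s := (1 / 2) ^ N) (δ := (1 / 2) ^ N) (by positivity)
    (pow_le_one₀ (by norm_num) (by norm_num)) (by positivity) (by positivity) hεL ?_
  intro a ha r hr hrN
  obtain ⟨i, hi, hi'⟩ := exists_nat_pow_near_of_lt_one hr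
    (hrN.le.trans (pow_le_one₀ (by norm_num) (by norm_num)))
    (show (0 : ℝ) < 1 / 2 by norm_num) (by norm_num)
  have hNi : N ≤ i := by
    by_contra hlt
    push Not at hlt
    have h1 : ((1 / 2 : ℝ)) ^ N ≤ (1 / 2) ^ (i + 1) :=
      pow_le_pow_of_le_one (by norm_num) (by norm_num) hlt
    linarith
  refine (measure_mono ?_).trans ((ha i hNi N le_rfl).trans ?_)
  · rintro x ⟨hx, hcone⟩
    exact ⟨mem_univ _, hx.trans_le hi', hcone⟩
  · refine ENNReal.ofReal_le_ofReal ?_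
    rw [mul_assoc, ← mul_pow]
    rw [pow_succ] at hi
    have : (1 / 2 : ℝ) ^ i ≤ 2 * r := by linarith
    rw [← mul_assoc 2]
    gcongr

theorem hausdorffMeasure_image_not_densityLE_eq_zero (μ : Measure X) [IsFiniteMeasure μ]
    {P : W → X → Y} {lam : W} (hP : Continuous (P lam)) :
    μH[(finrank ℝ Y : ℝ)] (P lam '' {a | ¬ ∃ N, DensityLE μ P (finrank ℝ Y) N lam a}) = 0 := by
  have h := ae_exists_measure_closedBall_le (μ.map (P lam)) (μH[(finrank ℝ Y : ℝ)] : Measure Y)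
  refine measure_mono_null ?_ (ae_iff.1 h)
  rintro _ ⟨a, ha, rfl⟩
  refine fun hN => ha (hN.imp fun N hN j hj => ?_)
  have h1 := hN j hj
  rwa [Measure.map_apply hP.measurable measurableSet_closedBall] at h1

theorem hausdorffMeasure_image_not_isolatedInFiber_eq_zero {Z : Type*} [MetricSpace Z]
    [MeasurableSpace Z] [BorelSpace Z] [SecondCountableTopology X] {d : ℝ} (hd : 0 ≤ d)
    (hX : μH[d] (univ : Set X) ≠ ⊤) {P : W → X → Z} {lam : W} {L : NNReal}
    (hP : LipschitzWith L (P lam)) :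
    μH[d] (P lam '' {a | ¬ ∃ N, IsolatedInFiber P N lam a}) = 0 := by
  refine measure_mono_null ?_ (hausdorffMeasure_infinite_fiber_eq_zero hd hX hP)
  rintro _ ⟨a, ha, rfl⟩
  intro hfin
  refine ha ?_
  have hopen : ((P lam ⁻¹' {P lam a}) \ {a})ᶜ ∈ 𝓝 a :=
    (hfin.sdiff).isClosed.isOpen_compl.mem_nhds (by simp)
  obtain ⟨δ, hδ, hsub⟩ := Metric.nhds_basis_closedBall.mem_iff.1 hopen
  obtain ⟨N, hN⟩ := exists_pow_lt_of_lt_one hδ (show (1 / 2 : ℝ) < 1 by norm_num)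
  refine ⟨N, fun x hx hPx => ?_⟩
  by_contra hne
  exact hsub (mem_closedBall.2 (hx.trans hN.le)) ⟨hPx, hne⟩

variable [NormedAddCommGroup W] [NormedSpace ℝ W] [FiniteDimensional ℝ W] [MeasurableSpace W]
  [BorelSpace W] [CompactSpace X]

/-- A compact space of finite Hausdorff measure without bi-Lipschitz pieces has null image under
almost every map of a transversal family. -/
theorem ae_hausdorffMeasure_range_eq_zero (κ : Measure W) [κ.IsAddHaarMeasure]
    (hX : μH[(finrank ℝ Y : ℝ)] (univ : Set X) ≠ ⊤)
    (hun : ∀ (f : X → Y) (Q : Set X) (c : ℝ), 0 < c →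
      (∀ x ∈ Q, ∀ y ∈ Q, c * dist x y ≤ dist (f x) (f y)) → μH[(finrank ℝ Y : ℝ)] Q = 0)
    {P : W → X → Y} {L : NNReal} (hPL : ∀ lam, LipschitzWith L (P lam))
    (hPm : ∀ x, Measurable fun lam => P lam x) {B : Set W} (hB : IsOpen B)
    (𝒥 : Finset (Y →L[ℝ] W)) {c₀ : ℝ} (hc₀ : 0 < c₀)
    (h𝒥 : ∀ lam ∈ B, ∀ x a, x ≠ a → dist (P lam x) (P lam a) ≤ c₀ * dist x a →
      ∃ J ∈ 𝒥, (x, a) ∈ transversalPairs P B J) :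
    ∀ᵐ lam ∂κ, lam ∈ B → μH[(finrank ℝ Y : ℝ)] (range (P lam)) = 0 := by
  set d := finrank ℝ Y
  set μ : Measure X := μH[(d : ℝ)] with hμ
  have : IsFiniteMeasure μ := ⟨hX.lt_top⟩
  have hPc : ∀ lam, Continuous (P lam) := fun lam => (hPL lam).continuous
  have hPu : Measurable (Function.uncurry P) :=
    (measurable_uncurry_of_continuous_of_measurable (u := fun x lam => P lam x) hPc hPm).comp
      measurable_swap
  obtain ⟨ε, hε, hεL⟩ : ∃ ε : ℝ, 0 < ε ∧ 2 * (ε * 2 ^ d) * (40 * (L + 1)) ^ d ≤ 1 / 2 := by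
    refine ⟨(4 * 2 ^ d * (40 * (L + 1)) ^ d)⁻¹, by positivity, le_of_eq ?_⟩
    field_simp
    norm_num
  have hgood : ∀ᵐ lam ∂κ, ∀ᵐ a ∂μ, lam ∈ B → (∃ N, DensityLE μ P d N lam a) →
      (∃ N, IsolatedInFiber P N lam a) → SmallCones μ P univ d ε lam a := by
    have hmeas : MeasurableSet {p : W × X | p.1 ∈ B → (∃ N, DensityLE μ P d N p.1 p.2) →
        (∃ N, IsolatedInFiber P N p.1 p.2) → SmallCones μ P univ d ε p.1 p.2} := by
      refine (measurable_fst hB.measurableSet).imp (MeasurableSet.imp ?_ (MeasurableSet.imp ?_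
        (measurableSet_smallCones hPu μ MeasurableSet.univ d ε)))
      · simpa only [ofPred_exists] using
          MeasurableSet.iUnion fun N => measurableSet_densityLE hPu μ d N
      · simpa only [ofPred_exists] using
          MeasurableSet.iUnion fun N => measurableSet_isolatedInFiber hPu hPc N
    refine (Measure.ae_ae_comm hmeas).2 (Eventually.of_forall fun a => ?_)
    have hae : ∀ᵐ lam ∂κ, ∀ J ∈ 𝒥, lam ∈ B → (∃ N, DensityLE μ P d N lam a) →
        (∃ N, IsolatedInFiber P N lam a) →
        SmallCones μ P (transversalPairs P B J) d (ε / (𝒥.card + 1)) lam a :=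
      (𝒥.eventually_all).2 fun J _ => ae_smallCones κ μ hPu hPc hB J a (by positivity)
    filter_upwards [hae] with lam hlam hlamB hD hI
    exact SmallCones.of_transversalPairs 𝒥 hc₀ hε.le (fun x => h𝒥 lam hlamB x a)
      fun J hJ => hlam J hJ hlamB hD hI
  filter_upwards [hgood] with lam hlam hlamB
  have himg : ∀ S : Set X, μ S = 0 → μH[(d : ℝ)] (P lam '' S) = 0 := fun S hS =>
    le_antisymm (((hPL lam).hausdorffMeasure_image_le (Nat.cast_nonneg d) S).trans
      (by rw [← hμ, hS, mul_zero])) bot_le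
  have hcover : range (P lam) ⊆
      P lam '' {a | SmallCones μ P univ d ε lam a} ∪
      (P lam '' {a | ¬ ∃ N, DensityLE μ P d N lam a} ∪
      (P lam '' {a | ¬ ∃ N, IsolatedInFiber P N lam a} ∪
      P lam '' {a | ¬ (lam ∈ B → (∃ N, DensityLE μ P d N lam a) →
        (∃ N, IsolatedInFiber P N lam a) → SmallCones μ P univ d ε lam a)})) := by
    rintro _ ⟨a, rfl⟩
    simp only [← image_union]
    refine mem_image_of_mem _ ?_
    simp only [mem_union, mem_ofPred_eq]
    tauto
  refine measure_mono_null hcover (measure_union_null ?_ (measure_union_null ?_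
    (measure_union_null ?_ ?_)))
  · exact himg _ (hausdorffMeasure_setOf_smallCones_eq_zero (hPL lam) hX (hun (P lam)) hε.le hεL)
  · exact hausdorffMeasure_image_not_densityLE_eq_zero μ (hPc lam)
  · exact hausdorffMeasure_image_not_isolatedInFiber_eq_zero (Nat.cast_nonneg d) hX (hPL lam)
  · exact himg _ (ae_iff.1 hlam)

end CompactFamilies

section UniformTransversality

variable {W Y : Type*} [NormedAddCommGroup W] [NormedSpace ℝ W]
  [NormedAddCommGroup Y] [NormedSpace ℝ Y]

theorem exists_finset_almost_right_inverse {S : Set (W →L[ℝ] Y)} (hS : IsCompact S)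
    (hinv : ∀ A ∈ S, ∃ J : Y →L[ℝ] W, A.comp J = ContinuousLinearMap.id ℝ Y) :
    ∃ 𝒥 : Finset (Y →L[ℝ] W), ∀ A ∈ S, ∃ J ∈ 𝒥, ∀ t, ‖A (J t) - t‖ ≤ 1 / 4 * ‖t‖ := by
  classical
  choose! J hJ using hinv
  have hpos : ∀ A : W →L[ℝ] Y, 0 < 1 / (4 * (‖J A‖ + 1)) := fun A => by positivity
  obtain ⟨F, hF, hcover⟩ := hS.elim_nhds_subcover (fun A => ball A (1 / (4 * (‖J A‖ + 1))))
    fun A _ => ball_mem_nhds A (hpos A)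
  refine ⟨F.image J, fun A hA => ?_⟩
  obtain ⟨A', hA', hAA'⟩ := mem_iUnion₂.1 (hcover hA)
  refine ⟨J A', Finset.mem_image_of_mem J hA', fun t => ?_⟩
  have h1 : A' (J A' t) = t := by
    simpa using congrArg (fun g : Y →L[ℝ] Y => g t) (hJ A' (hF A' hA'))
  have h2 : A (J A' t) - t = (A - A') (J A' t) := by
    rw [_root_.sub_apply, h1]
  rw [mem_ball, dist_eq_norm] at hAA'
  rw [h2]
  calc ‖(A - A') (J A' t)‖ ≤ ‖A - A'‖ * (‖J A'‖ * ‖t‖) :=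
        ((A - A').le_opNorm _).trans (by gcongr; exact (J A').le_opNorm t)
    _ ≤ 1 / (4 * (‖J A'‖ + 1)) * ((‖J A'‖ + 1) * ‖t‖) := by
        gcongr
        linarith
    _ = 1 / 4 * ‖t‖ := by
        field_simp

theorem norm_sub_sub_fderiv_le_of_norm_fderiv_fderiv_le {T : W → Y} {U : Set W} (hU : Convex ℝ U)
    {C r : ℝ} (hT : ∀ lam ∈ U, DifferentiableAt ℝ T lam)
    (hT' : ∀ lam ∈ U, DifferentiableAt ℝ (fderiv ℝ T) lam)
    (hC0 : 0 ≤ C) (hC : ∀ lam ∈ U, ‖fderiv ℝ (fderiv ℝ T) lam‖ ≤ C) {lam lam₁ lam₂ : W}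
    (h : lam ∈ U) (h₁ : lam₁ ∈ U) (h₂ : lam₂ ∈ U) (hr : ∀ lam' ∈ U, ‖lam' - lam‖ ≤ r) :
    ‖T lam₂ - T lam₁ - fderiv ℝ T lam (lam₂ - lam₁)‖ ≤ C * r * ‖lam₂ - lam₁‖ := by
  refine hU.norm_image_sub_le_of_norm_hasFDerivWithin_le' (f' := fderiv ℝ T)
    (fun x hx => (hT x hx).hasFDerivAt.hasFDerivWithinAt) (fun x hx => ?_) h₁ h₂
  refine (hU.norm_image_sub_le_of_norm_fderiv_le hT' hC h hx).trans ?_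
  gcongr
  exact hr x hx

variable [FiniteDimensional ℝ W]

theorem exists_norm_fderiv_le {ι : Type*} {T : ι → W → Y} {lam₀ : W} {r C : ℝ}
    (hr : 0 < r) (hT : ∀ i, ∀ lam ∈ ball lam₀ r, DifferentiableAt ℝ (T i) lam)
    (hT' : ∀ i, ∀ lam ∈ ball lam₀ r, DifferentiableAt ℝ (fderiv ℝ (T i)) lam) (hC0 : 0 ≤ C)
    (hC : ∀ i, ∀ lam ∈ ball lam₀ r, ‖fderiv ℝ (fderiv ℝ (T i)) lam‖ ≤ C)
    (hbdd : ∀ lam ∈ ball lam₀ r, ∃ L, ∀ i, ‖T i lam‖ ≤ L) :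
    ∃ M, ∀ i, ‖fderiv ℝ (T i) lam₀‖ ≤ M := by
  have hmem : lam₀ ∈ ball lam₀ r := mem_ball_self hr
  refine banach_steinhaus fun v => ?_
  set τ : ℝ := r / (2 * (‖v‖ + 1)) with hτ
  have hτ0 : 0 < τ := by positivity
  have hv : lam₀ + τ • v ∈ ball lam₀ r := by
    rw [mem_ball, dist_eq_norm, add_sub_cancel_left, norm_smul, Real.norm_of_nonneg hτ0.le, hτ,
      div_mul_eq_mul_div, div_lt_iff₀ (by positivity)]
    nlinarith [norm_nonneg v]
  obtain ⟨L₀, hL₀⟩ := hbdd lam₀ hmem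
  obtain ⟨L₁, hL₁⟩ := hbdd _ hv
  refine ⟨τ⁻¹ * (L₁ + L₀ + C * r * ‖τ • v‖), fun i => ?_⟩
  have h := norm_sub_sub_fderiv_le_of_norm_fderiv_fderiv_le (convex_ball lam₀ r) (hT i) (hT' i) hC0
    (hC i) hmem hmem hv fun lam' h' => (mem_ball_iff_norm.1 h').le
  rw [add_sub_cancel_left, map_smul] at h
  have h2 : ‖τ • fderiv ℝ (T i) lam₀ v‖ ≤ L₁ + L₀ + C * r * ‖τ • v‖ := by
    have e : τ • fderiv ℝ (T i) lam₀ v = T i (lam₀ + τ • v) - T i lam₀ -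
        (T i (lam₀ + τ • v) - T i lam₀ - τ • fderiv ℝ (T i) lam₀ v) := by abel
    rw [e]
    exact (norm_sub_le _ _).trans (add_le_add ((norm_sub_le _ _).trans
      (add_le_add (hL₁ i) (hL₀ i))) h)
  rw [norm_smul, Real.norm_of_nonneg hτ0.le] at h2
  rwa [← inv_mul_le_iff₀ (by positivity), inv_inv]

/-- A pointwise bounded family of maps with bounded second derivative, whose derivatives are
uniformly surjective wherever the maps are small, is locally close to translations along finitely
many linear slices. -/
theorem exists_ball_close_to_translation [FiniteDimensional ℝ Y] {ι : Type*} {T : ι → W → Y}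
    {U : Set W} (hU : IsOpen U) {lam₀ : W} (hlam₀ : lam₀ ∈ U) {C c₀ : ℝ}
    (hT : ∀ i, ∀ lam ∈ U, DifferentiableAt ℝ (T i) lam)
    (hT' : ∀ i, ∀ lam ∈ U, DifferentiableAt ℝ (fderiv ℝ (T i)) lam)
    (hC : ∀ i, ∀ lam ∈ U, ‖fderiv ℝ (fderiv ℝ (T i)) lam‖ ≤ C)
    (hbdd : ∀ lam ∈ U, ∃ L, ∀ i, ‖T i lam‖ ≤ L) {Z : Set (W →L[ℝ] Y)} (hZ : IsClosed Z)
    (hinv : ∀ A ∈ Z, ∃ J : Y →L[ℝ] W, A.comp J = ContinuousLinearMap.id ℝ Y)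
    (hTZ : ∀ i, ∀ lam ∈ U, ‖T i lam‖ ≤ c₀ → fderiv ℝ (T i) lam ∈ Z) :
    ∃ ρ > 0, ball lam₀ ρ ⊆ U ∧ (∃ L, ∀ lam ∈ ball lam₀ ρ, ∀ i, ‖T i lam‖ ≤ L) ∧
      ∃ 𝒥 : Finset (Y →L[ℝ] W), ∀ lam ∈ ball lam₀ ρ, ∀ i, ‖T i lam‖ ≤ c₀ →
        ∃ J ∈ 𝒥, ∀ lam₁ ∈ ball lam₀ ρ, ∀ t, lam₁ + J t ∈ ball lam₀ ρ →
          ‖T i (lam₁ + J t) - T i lam₁ - t‖ ≤ 1 / 2 * ‖t‖ := by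
  obtain ⟨r, hr, hrU⟩ := Metric.isOpen_iff.1 hU lam₀ hlam₀
  have hmem : lam₀ ∈ ball lam₀ r := mem_ball_self hr
  obtain ⟨C', hC0, hC'⟩ : ∃ C' ≥ 0, ∀ i, ∀ lam ∈ ball lam₀ r,
      ‖fderiv ℝ (fderiv ℝ (T i)) lam‖ ≤ C' :=
    ⟨max C 0, le_max_right _ _, fun i lam h => (hC i lam (hrU h)).trans (le_max_left _ _)⟩
  have hTr : ∀ i, ∀ lam ∈ ball lam₀ r, DifferentiableAt ℝ (T i) lam :=
    fun i lam h => hT i lam (hrU h)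
  have hTr' : ∀ i, ∀ lam ∈ ball lam₀ r, DifferentiableAt ℝ (fderiv ℝ (T i)) lam :=
    fun i lam h => hT' i lam (hrU h)
  obtain ⟨M, hM⟩ := exists_norm_fderiv_le hr hTr hTr' hC0 hC' fun lam h => hbdd lam (hrU h)
  have hfd : ∀ i, ∀ lam ∈ ball lam₀ r, ‖fderiv ℝ (T i) lam‖ ≤ M + C' * r := by
    intro i lam hlam
    have h := (convex_ball lam₀ r).norm_image_sub_le_of_norm_fderiv_le (hTr' i) (hC' i) hmem hlam
    have h2 : ‖lam - lam₀‖ ≤ r := (mem_ball_iff_norm.1 hlam).le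
    calc ‖fderiv ℝ (T i) lam‖
        ≤ ‖fderiv ℝ (T i) lam₀‖ + ‖fderiv ℝ (T i) lam - fderiv ℝ (T i) lam₀‖ :=
          norm_le_norm_add_norm_sub' _ _
      _ ≤ M + C' * r := add_le_add (hM i) (h.trans (by gcongr))
  have hS : IsCompact (closedBall 0 (M + C' * r) ∩ Z) :=
    (isCompact_closedBall (0 : W →L[ℝ] Y) (M + C' * r)).inter_right hZ
  obtain ⟨𝒥, h𝒥⟩ := exists_finset_almost_right_inverse hS fun A hA => hinv A hA.2
  set M' : ℝ := ∑ J ∈ 𝒥, ‖J‖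
  have hM'0 : 0 ≤ M' := Finset.sum_nonneg fun J _ => norm_nonneg J
  have hM' : ∀ J ∈ 𝒥, ‖J‖ ≤ M' := fun J hJ =>
    Finset.single_le_sum (f := fun J : Y →L[ℝ] W => ‖J‖) (fun J _ => norm_nonneg J) hJ
  set ρ : ℝ := min r (1 / (8 * ((C' + 1) * (M' + 1)))) with hρ
  have hρ0 : 0 < ρ := lt_min hr (by positivity)
  have hρr : ball lam₀ ρ ⊆ ball lam₀ r := ball_subset_ball (min_le_left _ _)
  have hρC : C' * (2 * ρ) * M' ≤ 1 / 4 := by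
    calc C' * (2 * ρ) * M' ≤ (C' + 1) * (2 * (1 / (8 * ((C' + 1) * (M' + 1))))) * (M' + 1) := by
          gcongr
          · linarith
          · exact min_le_right _ _
          · linarith
      _ = 1 / 4 := by
          field_simp
          norm_num
  refine ⟨ρ, hρ0, hρr.trans hrU, ?_, 𝒥, ?_⟩
  · obtain ⟨L₀, hL₀⟩ := hbdd lam₀ hlam₀
    refine ⟨L₀ + (M + C' * r) * r, fun lam hlam i => ?_⟩
    have hlamr := hρr hlam
    have h := (convex_ball lam₀ r).norm_image_sub_le_of_norm_fderiv_le (hTr i) (hfd i) hmem hlamr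
    have h2 : ‖lam - lam₀‖ ≤ r := (mem_ball_iff_norm.1 hlamr).le
    have h3 : 0 ≤ M + C' * r := (norm_nonneg _).trans (hfd i lam hlamr)
    calc ‖T i lam‖ ≤ ‖T i lam₀‖ + ‖T i lam - T i lam₀‖ := norm_le_norm_add_norm_sub' _ _
      _ ≤ L₀ + (M + C' * r) * r := add_le_add (hL₀ i) (h.trans (by gcongr))
  · intro lam hlam i hi
    obtain ⟨J, hJ, hJt⟩ := h𝒥 (fderiv ℝ (T i) lam)
      ⟨mem_closedBall_zero_iff.2 (hfd i lam (hρr hlam)), hTZ i lam (hrU (hρr hlam)) hi⟩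
    refine ⟨J, hJ, fun lam₁ h₁ t h₂ => ?_⟩
    have h := norm_sub_sub_fderiv_le_of_norm_fderiv_fderiv_le (convex_ball lam₀ ρ)
      (fun lam h => hTr i lam (hρr h)) (fun lam h => hTr' i lam (hρr h)) hC0
      (fun lam h => hC' i lam (hρr h)) hlam h₁ h₂ (r := 2 * ρ) fun lam' h' => by
        rw [← dist_eq_norm]
        exact (dist_triangle_right lam' lam lam₀).trans
          (by linarith [mem_ball.1 h', mem_ball.1 hlam])
    rw [add_sub_cancel_left] at h
    have hJn : ‖J t‖ ≤ M' * ‖t‖ := (J.le_opNorm t).trans (by gcongr; exact hM' J hJ)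
    have h3 : C' * (2 * ρ) * ‖J t‖ ≤ 1 / 4 * ‖t‖ := by
      calc C' * (2 * ρ) * ‖J t‖ ≤ C' * (2 * ρ) * (M' * ‖t‖) := by gcongr
        _ = C' * (2 * ρ) * M' * ‖t‖ := by ring
        _ ≤ 1 / 4 * ‖t‖ := by gcongr
    calc ‖T i (lam₁ + J t) - T i lam₁ - t‖
        = ‖(T i (lam₁ + J t) - T i lam₁ - fderiv ℝ (T i) lam (J t)) +
            (fderiv ℝ (T i) lam (J t) - t)‖ := by
          congr 1
          abel
      _ ≤ C' * (2 * ρ) * ‖J t‖ + 1 / 4 * ‖t‖ := (norm_add_le _ _).trans (add_le_add h (hJt t))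
      _ ≤ 1 / 2 * ‖t‖ := by linarith

end UniformTransversality

section Euclidean

variable {l m n : ℕ}

theorem toEuclideanLin_matrixOf (A : EuclideanSpace ℝ (Fin l) →L[ℝ] EuclideanSpace ℝ (Fin m)) :
    Matrix.toEuclideanLin (matrixOf A) = (A : EuclideanSpace ℝ (Fin l) →ₗ[ℝ] _) := by
  refine (EuclideanSpace.basisFun (Fin l) ℝ).toBasis.ext fun j => ?_
  ext i
  simp [matrixOf, Matrix.mulVec_single, Matrix.toLpLin_apply]

theorem exists_right_inverse_of_det_pos
    {A : EuclideanSpace ℝ (Fin l) →L[ℝ] EuclideanSpace ℝ (Fin m)}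
    (hA : 0 < (matrixOf A * (matrixOf A)ᵀ).det) :
    ∃ J : EuclideanSpace ℝ (Fin m) →L[ℝ] EuclideanSpace ℝ (Fin l),
      A.comp J = ContinuousLinearMap.id ℝ _ := by
  set M := matrixOf A with hM
  refine ⟨LinearMap.toContinuousLinearMap (Matrix.toEuclideanLin (Mᵀ * (M * Mᵀ)⁻¹)), ?_⟩
  have h1 : M * (Mᵀ * (M * Mᵀ)⁻¹) = 1 := by
    rw [← Matrix.mul_assoc]
    exact Matrix.mul_nonsing_inv _ hA.ne'.isUnit
  have h2 := Matrix.toLpLin_mul_same 2 M (Mᵀ * (M * Mᵀ)⁻¹)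
  rw [h1, Matrix.toLpLin_one] at h2
  ext t : 1
  have h3 := congrArg (fun g => g t) h2
  have h4 := toEuclideanLin_matrixOf A
  rw [← hM] at h4
  simp only [LinearMap.id_coe, id_eq, LinearMap.comp_apply] at h3
  rw [← Matrix.toEuclideanLin, h4] at h3
  exact h3.symm

theorem isClosed_setOf_le_det_matrixOf (c : ℝ) :
    IsClosed {A : EuclideanSpace ℝ (Fin l) →L[ℝ] EuclideanSpace ℝ (Fin m) |
      c ≤ (matrixOf A * (matrixOf A)ᵀ).det} := by
  have h : Continuous fun A : EuclideanSpace ℝ (Fin l) →L[ℝ] EuclideanSpace ℝ (Fin m) =>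
      matrixOf A :=
    continuous_matrix fun i j => by
      unfold matrixOf
      fun_prop
  exact isClosed_le continuous_const (h.matrix_mul h.matrix_transpose).matrix_det

/-- A purely unrectifiable set has no part of positive measure on which a map to `ℝ^m` is
bi-Lipschitz from below. -/
theorem PurelyUnrectifiable.hausdorffMeasure_eq_zero {E K : Set (EuclideanSpace ℝ (Fin n))}
    (hE : PurelyUnrectifiable m n E) (hKE : K ⊆ E) (f : K → EuclideanSpace ℝ (Fin m)) (Q : Set K)
    {c : ℝ} (hc : 0 < c) (hf : ∀ x ∈ Q, ∀ y ∈ Q, c * dist x y ≤ dist (f x) (f y)) :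
    μH[(m : ℝ)] Q = 0 := by
  rcases Q.eq_empty_or_nonempty with rfl | ⟨x₀, -⟩
  · exact measure_empty
  have : Nonempty K := ⟨x₀⟩
  have hinj : InjOn f Q := by
    intro x hx y hy hxy
    have h := hf x hx y hy
    rw [hxy, dist_self] at h
    exact dist_le_zero.1 (nonpos_of_mul_nonpos_right h hc)
  have hinv : ∀ x ∈ Q, Function.invFunOn f Q (f x) = x := hinj.leftInvOn_invFunOn
  have hlip : LipschitzOnWith (Real.toNNReal c⁻¹)
      (fun y => ((Function.invFunOn f Q y : K) : EuclideanSpace ℝ (Fin n))) (f '' Q) := by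
    refine LipschitzOnWith.of_dist_le_mul ?_
    rintro _ ⟨x, hx, rfl⟩ _ ⟨y, hy, rfl⟩
    rw [hinv x hx, hinv y hy, Real.coe_toNNReal _ (by positivity), ← div_eq_inv_mul,
      le_div_iff₀ hc, mul_comm]
    exact hf x hx y hy
  obtain ⟨g, hg, hgeq⟩ := hlip.extend_finite_dimension
  rw [← isometry_subtype_coe.hausdorffMeasure_image (Or.inl (Nat.cast_nonneg m)) Q]
  refine measure_mono_null ?_ (hE g ⟨_, hg⟩)
  rintro _ ⟨x, hx, rfl⟩
  refine ⟨hKE x.2, f x, ?_⟩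
  rw [← hgeq (mem_image_of_mem f hx)]
  exact congrArg Subtype.val (hinv x hx)

variable {Λ : Set (EuclideanSpace ℝ (Fin l))}
  {P : EuclideanSpace ℝ (Fin l) → EuclideanSpace ℝ (Fin n) → EuclideanSpace ℝ (Fin m)}

theorem hasFDerivAt_Tmap {x y : EuclideanSpace ℝ (Fin n)} {lam : EuclideanSpace ℝ (Fin l)}
    (hx : DifferentiableAt ℝ (fun μ => P μ x) lam) (hy : DifferentiableAt ℝ (fun μ => P μ y) lam) :
    HasFDerivAt (Tmap P x y)
      (‖x - y‖⁻¹ • (fderiv ℝ (fun μ => P μ x) lam - fderiv ℝ (fun μ => P μ y) lam)) lam :=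
  (hx.hasFDerivAt.sub hy.hasFDerivAt).const_smul ‖x - y‖⁻¹

theorem differentiableAt_fderiv_Tmap (hΛ : IsOpen Λ) {x y : EuclideanSpace ℝ (Fin n)}
    (hx : ∀ lam ∈ Λ, DifferentiableAt ℝ (fun μ => P μ x) lam ∧
      DifferentiableAt ℝ (fun μ => fderiv ℝ (fun ν => P ν x) μ) lam)
    (hy : ∀ lam ∈ Λ, DifferentiableAt ℝ (fun μ => P μ y) lam ∧
      DifferentiableAt ℝ (fun μ => fderiv ℝ (fun ν => P ν y) μ) lam)
    {lam : EuclideanSpace ℝ (Fin l)} (hlam : lam ∈ Λ) :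
    DifferentiableAt ℝ (fderiv ℝ (Tmap P x y)) lam := by
  have heq : fderiv ℝ (Tmap P x y) =ᶠ[𝓝 lam] fun lam => ‖x - y‖⁻¹ •
      (fderiv ℝ (fun μ => P μ x) lam - fderiv ℝ (fun μ => P μ y) lam) := by
    filter_upwards [hΛ.mem_nhds hlam] with lam' h'
    exact (hasFDerivAt_Tmap (hx lam' h').1 (hy lam' h').1).fderiv
  rw [heq.differentiableAt_iff]
  exact ((hx lam hlam).2.sub (hy lam hlam).2).const_smul ‖x - y‖⁻¹

theorem norm_sub_eq_dist_mul_norm_Tmap {x y : EuclideanSpace ℝ (Fin n)} (hxy : x ≠ y)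
    (lam : EuclideanSpace ℝ (Fin l)) : ‖P lam x - P lam y‖ = dist x y * ‖Tmap P x y lam‖ := by
  have h : ‖x - y‖ ≠ 0 := norm_ne_zero_iff.2 (sub_ne_zero.2 hxy)
  rw [Tmap, norm_smul, norm_inv, norm_norm, dist_eq_norm, mul_inv_cancel_left₀ h]

/-- The conclusion for compact subsets, locally in the parameter. -/
theorem exists_ball_ae_image_null (hΛ : IsOpen Λ) (hP : IsTransversalFamilyLip Λ P)
    {E K : Set (EuclideanSpace ℝ (Fin n))} (hEfin : μH[m] E < ⊤)
    (hEunrect : PurelyUnrectifiable m n E) (hKE : K ⊆ E) (hK : IsCompact K)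
    {lam₀ : EuclideanSpace ℝ (Fin l)} (hlam₀ : lam₀ ∈ Λ) :
    ∃ ρ > 0, ∀ᵐ lam ∂(volume : Measure (EuclideanSpace ℝ (Fin l))),
      lam ∈ ball lam₀ ρ → μH[m] (P lam '' K) = 0 := by
  classical
  obtain ⟨⟨-, hLip, hdiff⟩, -, ⟨C_T, hCT, hdet⟩, C_L, hC_L⟩ := hP K hK
  have hdiff' : ∀ x ∈ K, ∀ lam ∈ Λ, DifferentiableAt ℝ (fun μ => P μ x) lam ∧
      DifferentiableAt ℝ (fun μ => fderiv ℝ (fun ν => P ν x) μ) lam :=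
    fun x hx lam hlam => hdiff lam hlam x hx
  let T : {p : K × K // p.1 ≠ p.2} → EuclideanSpace ℝ (Fin l) → EuclideanSpace ℝ (Fin m) :=
    fun i => Tmap P i.1.1 i.1.2
  have hne : ∀ i : {p : K × K // p.1 ≠ p.2}, (i.1.1 : EuclideanSpace ℝ (Fin n)) ≠ i.1.2 :=
    fun i => Subtype.coe_injective.ne i.2
  obtain ⟨ρ, hρ, hρΛ, ⟨L, hL⟩, 𝒥, h𝒥⟩ := exists_ball_close_to_translation (T := T) hΛ hlam₀
    (C := C_L) (c₀ := C_T)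
    (fun i lam hlam => (hasFDerivAt_Tmap (hdiff lam hlam _ i.1.1.2).1
      (hdiff lam hlam _ i.1.2.2).1).differentiableAt)
    (fun i lam hlam => differentiableAt_fderiv_Tmap hΛ (hdiff' _ i.1.1.2) (hdiff' _ i.1.2.2) hlam)
    (fun i lam hlam => hC_L lam hlam _ i.1.1.2 _ i.1.2.2 (hne i))
    (fun lam hlam => by
      obtain ⟨L, hL⟩ := hLip lam hlam
      refine ⟨L, fun i => ?_⟩
      have h := hL.dist_le_mul _ i.1.1.2 _ i.1.2.2
      rw [dist_eq_norm, norm_sub_eq_dist_mul_norm_Tmap (hne i), mul_comm] at h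
      exact le_of_mul_le_mul_right h (dist_pos.2 (hne i)))
    (isClosed_setOf_le_det_matrixOf (C_T ^ 2))
    (fun A hA => exists_right_inverse_of_det_pos (lt_of_lt_of_le (by positivity) hA))
    (fun i lam hlam hi => hdet lam hlam _ i.1.1.2 _ i.1.2.2 (hne i) hi)
  refine ⟨ρ, hρ, ?_⟩
  set B := ball lam₀ ρ
  let P' : EuclideanSpace ℝ (Fin l) → K → EuclideanSpace ℝ (Fin m) := fun lam x =>
    B.piecewise (fun lam => P lam x) 0 lam
  have hP' : ∀ lam ∈ B, ∀ x, P' lam x = P lam x := fun lam hlam x =>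
    piecewise_eq_of_mem _ _ _ hlam
  have : CompactSpace K := isCompact_iff_compactSpace.1 hK
  have hX : μH[(m : ℝ)] (univ : Set K) ≠ ⊤ := by
    rw [← isometry_subtype_coe.hausdorffMeasure_image (Or.inl (Nat.cast_nonneg m)) univ,
      image_univ, Subtype.range_coe]
    exact measure_ne_top_of_subset hKE hEfin.ne
  have hPL : ∀ lam, LipschitzWith L.toNNReal (P' lam) := by
    intro lam
    refine LipschitzWith.of_dist_le_mul fun x y => ?_
    by_cases hlam : lam ∈ B
    · by_cases hxy : x = y
      · simp [hxy]
      · rw [hP' lam hlam, hP' lam hlam, dist_eq_norm,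
          norm_sub_eq_dist_mul_norm_Tmap (Subtype.coe_injective.ne hxy), mul_comm]
        gcongr
        · exact (hL lam hlam ⟨(x, y), hxy⟩).trans (Real.le_coe_toNNReal L)
        · exact le_rfl
    · simp only [P', piecewise_eq_of_notMem _ _ _ hlam, Pi.zero_apply, dist_self]
      positivity
  have hPm : ∀ x, Measurable fun lam => P' lam x := fun x =>
    ContinuousOn.measurable_piecewise
      (fun lam hlam => (hdiff lam (hρΛ hlam) x x.2).1.continuousAt.continuousWithinAt)
      continuousOn_const measurableSet_ball
  have htrans : ∀ lam ∈ B, ∀ x a, x ≠ a → dist (P' lam x) (P' lam a) ≤ C_T * dist x a →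
      ∃ J ∈ 𝒥, (x, a) ∈ transversalPairs P' B J := by
    intro lam hlam x a hxa hle
    have hxa' : (x : EuclideanSpace ℝ (Fin n)) ≠ a := Subtype.coe_injective.ne hxa
    have hd : 0 < dist x a := dist_pos.2 hxa
    rw [hP' lam hlam, hP' lam hlam, dist_eq_norm, norm_sub_eq_dist_mul_norm_Tmap hxa',
      mul_comm] at hle
    obtain ⟨J, hJ, hJt⟩ := h𝒥 lam hlam ⟨(x, a), hxa⟩ (le_of_mul_le_mul_right hle hd)
    refine ⟨J, hJ, fun lam₁ h₁ t h₂ => ?_⟩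
    have h := hJt lam₁ h₁ t h₂
    have hT : ∀ lam, P lam x - P lam a = dist x a • Tmap P x a lam := fun lam => by
      rw [Tmap, ← dist_eq_norm, ← Subtype.dist_eq, smul_inv_smul₀ hd.ne']
    simp only [hP' _ h₁, hP' _ h₂]
    rw [hT, hT, ← smul_sub, ← smul_sub, norm_smul, Real.norm_of_nonneg hd.le]
    calc _ ≤ dist x a * (1 / 2 * ‖t‖) := by gcongr
      _ = _ := by ring
  have hfin : finrank ℝ (EuclideanSpace ℝ (Fin m)) = m := finrank_euclideanSpace_fin
  have hmain := ae_hausdorffMeasure_range_eq_zero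
    (volume : Measure (EuclideanSpace ℝ (Fin l))) (by rwa [hfin])
    (fun f Q c hc hf => by
      rw [hfin]
      exact hEunrect.hausdorffMeasure_eq_zero hKE f Q hc hf)
    hPL hPm isOpen_ball 𝒥 hCT htrans
  filter_upwards [hmain] with lam hlam hlamB
  have h := hlam hlamB
  rw [hfin] at h
  convert h using 2
  rw [image_eq_range]
  exact congrArg range (funext fun x => (hP' lam hlamB x).symm)

theorem ae_image_null_of_isCompact (hΛ : IsOpen Λ) (hP : IsTransversalFamilyLip Λ P)
    {E K : Set (EuclideanSpace ℝ (Fin n))} (hEfin : μH[m] E < ⊤)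
    (hEunrect : PurelyUnrectifiable m n E) (hKE : K ⊆ E) (hK : IsCompact K) :
    ∀ᵐ lam ∂(volume : Measure (EuclideanSpace ℝ (Fin l))),
      lam ∈ Λ → μH[m] (P lam '' K) = 0 := by
  rw [ae_iff]
  refine measure_null_of_locally_null _ fun lam₀ hlam₀ => ?_
  rw [mem_ofPred_eq, Classical.not_imp] at hlam₀
  obtain ⟨ρ, hρ, h⟩ := exists_ball_ae_image_null hΛ hP hEfin hEunrect hKE hK hlam₀.1
  refine ⟨_, inter_mem_nhdsWithin _ (ball_mem_nhds lam₀ hρ), measure_mono_null ?_ (ae_iff.1 h)⟩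
  rintro lam ⟨hlam, hB⟩ himp
  exact hlam fun _ => himp hB

theorem IsTransversalFamilyLip.hausdorffMeasure_image_eq_zero (hP : IsTransversalFamilyLip Λ P)
    {lam : EuclideanSpace ℝ (Fin l)} (hlam : lam ∈ Λ) {N : Set (EuclideanSpace ℝ (Fin n))}
    (hN : μH[m] N = 0) : μH[m] (P lam '' N) = 0 := by
  have hcover : P lam '' N ⊆ ⋃ k : ℕ, P lam '' (N ∩ closedBall 0 k) := by
    rw [← image_iUnion, ← inter_iUnion, iUnion_closedBall_nat, inter_univ]
  refine measure_mono_null hcover (measure_iUnion_null fun k => ?_)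
  obtain ⟨L, hL⟩ := (hP _ (isCompact_closedBall 0 (k : ℝ))).1.2.1 lam hlam
  refine le_antisymm (((hL.mono inter_subset_right).hausdorffMeasure_image_le
    (Nat.cast_nonneg m)).trans ?_) bot_le
  rw [measure_mono_null inter_subset_left hN, mul_zero]

theorem exists_isCompact_iUnion_null {X : Type*} [TopologicalSpace X] [PolishSpace X]
    [MeasurableSpace X] [BorelSpace X] {μ : Measure X} {E : Set X} (hE : MeasurableSet E)
    (hEfin : μ E < ⊤) :
    ∃ K : ℕ → Set X, (∀ k, K k ⊆ E ∧ IsCompact (K k)) ∧ μ (E \ ⋃ k, K k) = 0 := by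
  have : IsFiniteMeasure (μ.restrict E) := ⟨by rwa [Measure.restrict_apply_univ]⟩
  have h : ∀ k : ℕ, ∃ K ⊆ E, IsCompact K ∧ μ.restrict E (E \ K) < (k : ℝ≥0∞)⁻¹ :=
    fun k => hE.exists_isCompact_sdiff_lt (measure_ne_top _ _) (by simp)
  choose K hKE hK hlt using h
  refine ⟨K, fun k => ⟨hKE k, hK k⟩, ?_⟩
  refine le_antisymm (ge_of_tendsto' ENNReal.tendsto_inv_nat_nhds_zero fun k => ?_) bot_le
  have hlt' := hlt k
  rw [Measure.restrict_eq_self _ sdiff_subset] at hlt'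
  exact (measure_mono (sdiff_subset_sdiff_right (subset_iUnion K k))).trans hlt'.le

end Euclidean

/-- If `{P_λ}_{λ∈Λ}` satisfies conditions (2), (3), (4) of transversality and the weakened
condition (1'), and `E ⊆ ℝⁿ` is an `H^m`-measurable, purely `m`-unrectifiable set with
`H^m(E) < ∞`, then `H^m(P_λ(E)) = 0` for `L^l`-almost every `λ ∈ Λ`. -/
theorem unrectifiable_ae_proj_null {l m n : ℕ} (hml : m ≤ l) (hmn : m < n)
    (Λ : Set (EuclideanSpace ℝ (Fin l))) (hΛ : IsOpen Λ)
    (P : EuclideanSpace ℝ (Fin l) → EuclideanSpace ℝ (Fin n) → EuclideanSpace ℝ (Fin m))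
    (hP : IsTransversalFamilyLip Λ P)
    (E : Set (EuclideanSpace ℝ (Fin n))) (hE : MeasurableSet E) (hEfin : μH[m] E < ⊤)
    (hEunrect : PurelyUnrectifiable m n E) :
    ∀ᵐ lam ∂(volume : Measure (EuclideanSpace ℝ (Fin l))),
      lam ∈ Λ → μH[m] (P lam '' E) = 0 := by
  obtain ⟨K, hK, hnull⟩ := exists_isCompact_iUnion_null hE hEfin
  have hae := ae_all_iff.2 fun k =>
    ae_image_null_of_isCompact hΛ hP hEfin hEunrect (hK k).1 (hK k).2
  filter_upwards [hae] with lam hlam hlamΛ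
  have hcover : P lam '' E ⊆ (⋃ k, P lam '' K k) ∪ P lam '' (E \ ⋃ k, K k) := by
    rw [← image_iUnion, ← image_union]
    exact image_mono fun x hx => or_iff_not_imp_left.2 fun h => ⟨hx, h⟩
  exact measure_mono_null hcover (measure_union_null
    (measure_iUnion_null fun k => hlam k hlamΛ)
    (hP.hausdorffMeasure_image_eq_zero hlamΛ hnull))
end

section
/- Let m < n be positive integers, let E ⊂ ℝⁿ with H^m(E) < ∞, and let P : ℝⁿ → ℝ^m be Lipschitz continuous. Define E₃ := {a ∈ E : the set E ∩ P^{−1}(P(a)) is infinite}. Then H^m(P(E₃)) = 0. -/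
open MeasureTheory Set Metric

open Filter Topology
open scoped ENNReal NNReal

/-- The code of a point `x` recording its membership in the first `k` sets of a countable
separating family of measurable sets. -/
noncomputable def separatingCode (X : Type*) [MeasurableSpace X]
    [MeasurableSpace.CountablyGenerated X] (k : ℕ) (x : X) : Fin k → Bool :=
  fun i => MeasurableSpace.mapNatBool X x i

lemma measurable_separatingCode (X : Type*) [MeasurableSpace X]
    [MeasurableSpace.CountablyGenerated X] (k : ℕ) : Measurable (separatingCode X k) :=
  measurable_pi_lambda _ fun i =>
    (measurable_pi_apply (i : ℕ)).comp (MeasurableSpace.measurable_mapNatBool X)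

lemma eventually_injOn_separatingCode {X : Type*} [MeasurableSpace X]
    [MeasurableSpace.CountablyGenerated X] [MeasurableSpace.SeparatesPoints X] (t : Finset X) :
    ∀ᶠ k in atTop, InjOn (separatingCode X k) t := by
  have h : ∀ᶠ k in atTop, ∀ a ∈ t, ∀ b ∈ t, separatingCode X k a = separatingCode X k b →
      a = b := by
    refine (Filter.eventually_all_finset t).2 fun a _ =>
      (Filter.eventually_all_finset t).2 fun b _ => ?_
    by_cases hab : a = b
    · exact Eventually.of_forall fun _ _ => hab
    · obtain ⟨i, hi⟩ := Function.ne_iff.1 ((MeasurableSpace.injective_mapNatBool X).ne hab)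
      filter_upwards [eventually_gt_atTop i] with k hk hc
      exact absurd (congrFun hc ⟨i, hk⟩) hi
  filter_upwards [h] with k hk a ha b hb hc using hk a ha b hb hc

/-- A measurable upper bound for the number of pieces of `E`, cut according to
`separatingCode X k`, that meet the fibre of `P` over a given point. -/
noncomputable def fibreCount {X Y : Type*} [MeasurableSpace X]
    [MeasurableSpace.CountablyGenerated X] [MeasurableSpace Y] (ν : Measure Y) (P : X → Y)
    (E : Set X) (k : ℕ) (y : Y) : ℝ≥0∞ :=
  ∑ c : Fin k → Bool,
    (toMeasurable ν (P '' (separatingCode X k ⁻¹' {c} ∩ E))).indicator (fun _ => 1) y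

section fibreCount

variable {X Y : Type*} [MeasurableSpace X] [MeasurableSpace.CountablyGenerated X]
  [MeasurableSpace Y] (ν : Measure Y) {P : X → Y} {E : Set X}

lemma measurable_fibreCount (k : ℕ) : Measurable (fibreCount ν P E k) :=
  Finset.measurable_fun_sum _ fun _ _ =>
    measurable_const.indicator (measurableSet_toMeasurable _ _)

lemma card_le_fibreCount {k : ℕ} {y : Y} {t : Finset X} (ht : (t : Set X) ⊆ E ∩ P ⁻¹' {y})
    (hinj : InjOn (separatingCode X k) t) : (t.card : ℝ≥0∞) ≤ fibreCount ν P E k y := by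
  classical
  rw [← Finset.card_image_of_injOn hinj, Finset.cast_card, fibreCount]
  refine (Finset.sum_le_sum fun c hc => ?_).trans
    (Finset.sum_le_sum_of_subset (Finset.subset_univ _))
  obtain ⟨x, hx, rfl⟩ := Finset.mem_image.1 hc
  obtain ⟨hxE, hxy⟩ := ht hx
  have hy : y ∈ P '' (separatingCode X k ⁻¹' {separatingCode X k x} ∩ E) :=
    ⟨x, ⟨rfl, hxE⟩, hxy⟩
  rw [indicator_of_mem (subset_toMeasurable ν _ hy)]

lemma tendsto_fibreCount_of_infinite [MeasurableSpace.SeparatesPoints X] {y : Y}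
    (hy : (E ∩ P ⁻¹' {y}).Infinite) :
    Tendsto (fun k => fibreCount ν P E k y) atTop (𝓝 ⊤) := by
  refine ENNReal.tendsto_nhds_top fun j => ?_
  obtain ⟨t, ht, hcard⟩ := hy.exists_subset_card_eq (j + 1)
  filter_upwards [eventually_injOn_separatingCode t] with k hk
  refine lt_of_lt_of_le ?_ (card_le_fibreCount ν ht hk)
  rw [hcard]
  exact_mod_cast Nat.lt_succ_self j

lemma lintegral_fibreCount_le {μ : Measure X} {C : ℝ≥0∞}
    (hP : ∀ s : Set X, ν (P '' s) ≤ C * μ s) (k : ℕ) :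
    ∫⁻ y, fibreCount ν P E k y ∂ν ≤ C * μ E := by
  have hpre (c : Fin k → Bool) : MeasurableSet (separatingCode X k ⁻¹' {c}) :=
    measurable_separatingCode X k (measurableSet_singleton c)
  calc ∫⁻ y, fibreCount ν P E k y ∂ν
      = ∑ c : Fin k → Bool, ν (P '' (separatingCode X k ⁻¹' {c} ∩ E)) := by
        simp only [fibreCount]
        rw [lintegral_finsetSum _ fun c _ =>
          measurable_const.indicator (measurableSet_toMeasurable _ _)]
        refine Finset.sum_congr rfl fun c _ => ?_
        rw [lintegral_indicator_const (measurableSet_toMeasurable _ _), one_mul,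
          measure_toMeasurable]
    _ ≤ ∑ c : Fin k → Bool, C * μ.restrict E (separatingCode X k ⁻¹' {c}) :=
        Finset.sum_le_sum fun c _ => by
          rw [Measure.restrict_apply (hpre c)]
          exact hP _
    _ = C * μ E := by
        rw [← Finset.mul_sum, sum_measure_preimage_singleton _ fun c _ => hpre c]
        simp

/-- If `P` increases measure at most by a finite factor, then almost every point has finite fibre
in a set of finite measure. -/
theorem measure_setOf_infinite_fibre_eq_zero [MeasurableSpace.SeparatesPoints X]
    {μ : Measure X} {C : ℝ≥0∞} (hC : C ≠ ⊤) (hP : ∀ s : Set X, ν (P '' s) ≤ C * μ s)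
    (hE : μ E ≠ ⊤) : ν {y | (E ∩ P ⁻¹' {y}).Infinite} = 0 := by
  have hfatou : ∫⁻ y, liminf (fun k => fibreCount ν P E k y) atTop ∂ν ≠ ⊤ := by
    refine ne_top_of_le_ne_top (ENNReal.mul_ne_top hC hE)
      ((lintegral_liminf_le fun k => measurable_fibreCount ν k).trans ?_)
    exact liminf_le_of_frequently_le'
      (Frequently.of_forall fun k => lintegral_fibreCount_le ν hP k)
  have hae := ae_lt_top (Measurable.liminf fun k => measurable_fibreCount ν k) hfatou
  refine measure_mono_null (fun y hy => ?_) (ae_iff.1 hae)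
  intro hlt
  exact hlt.ne (tendsto_fibreCount_of_infinite ν hy).liminf_eq

end fibreCount

/-- If `E ⊆ ℝⁿ` has `H^m(E) < ∞` and `P : ℝⁿ → ℝ^m` is Lipschitz, then the image under `P` of
the set of points `a ∈ E` whose fibre `E ∩ P⁻¹(P a)` is infinite is `H^m`-null. -/
theorem image_null_of_infinite_fibre {m n : ℕ} (hm : 0 < m) (hmn : m < n)
    (E : Set (EuclideanSpace ℝ (Fin n))) (hEfin : μH[m] E < ⊤)
    (P : EuclideanSpace ℝ (Fin n) → EuclideanSpace ℝ (Fin m))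
    (hP : ∃ K : NNReal, LipschitzWith K P) :
    μH[m] (P '' {a ∈ E | (E ∩ P ⁻¹' {P a}).Infinite}) = 0 := by
  obtain ⟨K, hK⟩ := hP
  have hC : (K : ℝ≥0∞) ^ (m : ℝ) ≠ ⊤ :=
    ENNReal.rpow_ne_top_of_nonneg m.cast_nonneg ENNReal.coe_ne_top
  refine measure_mono_null ?_ (measure_setOf_infinite_fibre_eq_zero μH[m] hC
    (hK.hausdorffMeasure_image_le m.cast_nonneg) hEfin.ne)
  rintro _ ⟨a, ha, rfl⟩
  exact ha.2
end
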